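/- Let (R, m) be a complete Noetherian local ring, M a finite R-module of Krull dimension n ≥ 2, and let a_1 and a_2 be ideals of R. Then there exists an ideal b of R such that Att_R(H^n_b(M)) = Att_R(H^n_{a_1}(M)) ∩ Att_R(H^n_{a_2}(M)). -/

import Mathlib

/-!
STATEMENT 8 (Dibaei–Jafari, Lemma 2.7): `n = dim M ≥ 2`; for ideals `a₁, a₂` there is an
ideal `b` with `Att_R(H^n_b(M)) = Att_R(H^n_{a₁}(M)) ∩ Att_R(H^n_{a₂}(M))`.
-/

open CategoryTheory

noncomputable section

universe u

/-- A prime ideal `p` is an *attached prime* of the `R`-module `N` if `p` is the annihilator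
of some quotient of `N`. -/
def attachedPrimes (R : Type u) [CommRing R] (N : Type u) [AddCommGroup N] [Module R N] :
    Set (Ideal R) :=
  { p | p.IsPrime ∧ ∃ K : Submodule R N, p = Module.annihilator R (N ⧸ K) }

/-- `Assh_R(M)`: the associated primes `p` of `M` with `dim (R ⧸ p) = dim M`, where the
dimension of `M` is recorded by the natural number `n`. -/
def assh (R : Type u) [CommRing R] (M : Type u) [AddCommGroup M] [Module R M] (n : ℕ) :
    Set (Ideal R) :=
  { p ∈ associatedPrimes R M | ringKrullDim (R ⧸ p) = (n : WithBot (WithTop ℕ)) }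

namespace LC
section
variable {R : Type u} [CommRing R]

def yobj {C : Type*} [Category* C] [Abelian C] [Linear R C] {K L : ChainComplex C ℕ} (φ : K ⟶ L) (Y : C) :
    L.linearYonedaObj R Y ⟶ K.linearYonedaObj R Y :=
  (HomologicalComplex.unopFunctor _ _).map ((((linearYoneda R C).obj Y).rightOp.mapHomologicalComplex _).map φ).op

lemma isoExt_nat {X X' : ModuleCat.{u} R} (g : X' ⟶ X) (P : ProjectiveResolution X)
    (P' : ProjectiveResolution X') (φ : ProjectiveResolution.Hom P' P g) (Y : ModuleCat.{u} R) (n : ℕ) :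
    ((Ext R (ModuleCat.{u} R) n).map g.op).app Y ≫ (P'.isoExt n Y).hom =
      (P.isoExt n Y).hom ≫ HomologicalComplex.homologyMap (yobj φ.hom Y) n := by
  have h1 := ProjectiveResolution.isoLeftDerivedObj_inv_naturality g P' P φ.hom (by simpa using φ.hom_f_zero_comp_π_f_zero) ((linearYoneda R _).obj Y).rightOp n
  have h2 := HomologicalComplex.homologyOp_hom_naturality (yobj (R := R) φ.hom Y) n
  have h3 : ((Ext R (ModuleCat.{u} R) n).map g.op).app Y = ((((linearYoneda R (ModuleCat.{u} R)).obj Y).rightOp.leftDerived n).map g).unop := rfl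
  have h4 : ((HomologicalComplex.homologyOp (P'.complex.linearYonedaObj R Y) n).inv ≫ (P'.isoLeftDerivedObj ((linearYoneda R _).obj Y).rightOp n).inv) ≫ (((linearYoneda R (ModuleCat.{u} R)).obj Y).rightOp.leftDerived n).map g
     = (HomologicalComplex.homologyMap (yobj φ.hom Y) n).op ≫ ((HomologicalComplex.homologyOp (P.complex.linearYonedaObj R Y) n).inv ≫ (P.isoLeftDerivedObj ((linearYoneda R _).obj Y).rightOp n).inv) := by
    refine (Category.assoc _ _ _).trans ?_
    refine (congrArg (fun z => _ ≫ z) h1).trans ?_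
    refine (Category.assoc _ _ _).symm.trans ?_
    refine Eq.trans ?_ (Category.assoc _ _ _)
    refine congrArg (fun z => z ≫ _) ?_
    refine (Iso.inv_comp_eq _).2 ?_
    refine Eq.trans ?_ (Category.assoc _ _ _)
    exact (Iso.eq_comp_inv _).2 h2
  exact congrArg Quiver.Hom.unop h4


/-- cocycles -/
abbrev ZZ {X : ModuleCat.{u} R} (P : ProjectiveResolution X) (Y : ModuleCat.{u} R) (n : ℕ) : Submodule R (P.complex.X n ⟶ Y) :=
  LinearMap.ker (Linear.leftComp R Y (P.complex.d (n+1) n))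

def zExt {X : ModuleCat.{u} R} (P : ProjectiveResolution X) (Y : ModuleCat.{u} R) (n : ℕ) :
    ZZ P Y n →ₗ[R] Abelian.Ext.{u} X Y n where
  toFun f := P.extMk f.1 (n+1) rfl f.2
  map_add' f g := (P.add_extMk _ _ _ _ _ _).symm
  map_smul' r f := by
    have := P.extMk_comp_mk₀ f.1 (n+1) rfl f.2 (r • 𝟙 Y)
    simp only [Linear.comp_smul, Category.comp_id] at this
    simp only [Submodule.coe_smul, RingHom.id_apply]
    rw [← this, ← Abelian.Ext.smul_eq_comp_mk₀]

lemma zExt_surj {X : ModuleCat.{u} R} (P : ProjectiveResolution X) (Y : ModuleCat.{u} R) (n : ℕ) :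
    Function.Surjective (zExt P Y n) := fun a => by
  obtain ⟨f, hf, h⟩ := P.extMk_surjective a (n+1) rfl
  exact ⟨⟨f, hf⟩, h⟩

def zHom {X : ModuleCat.{u} R} (P : ProjectiveResolution X) (Y : ModuleCat.{u} R) (n : ℕ) :
    ZZ P Y n →ₗ[R] ((P.complex.linearYonedaObj R Y).homology n) :=
  ((P.complex.linearYonedaObj R Y).homologyπ n).hom ∘ₗ
   ((P.complex.linearYonedaObj R Y).liftCycles (A := ModuleCat.of R (ZZ P Y n)) (ModuleCat.ofHom (ZZ P Y n).subtype) (n+1) (by simp) (by ext x; exact x.2)).hom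

lemma zHom_surj {X : ModuleCat.{u} R} (P : ProjectiveResolution X) (Y : ModuleCat.{u} R) (n : ℕ) :
    Function.Surjective (zHom P Y n) := by
  intro a
  have h1 : Function.Surjective ((P.complex.linearYonedaObj R Y).homologyπ n).hom := (ModuleCat.epi_iff_surjective _).1 inferInstance
  obtain ⟨z, rfl⟩ := h1 a
  have hz : ((P.complex.linearYonedaObj R Y).iCycles n).hom z ∈ ZZ P Y n := by
    have := congrArg (fun f => f.hom z) ((P.complex.linearYonedaObj R Y).iCycles_d n (n+1))
    exact this
  refine ⟨⟨_, hz⟩, ?_⟩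
  simp only [zHom, LinearMap.comp_apply]
  congr 1
  have h2 : Function.Injective ((P.complex.linearYonedaObj R Y).iCycles n).hom := (ModuleCat.mono_iff_injective _).1 inferInstance
  apply h2
  have := congrArg (fun f => f.hom ⟨_, hz⟩) ((P.complex.linearYonedaObj R Y).liftCycles_i (A := ModuleCat.of R (ZZ P Y n)) (ModuleCat.ofHom (ZZ P Y n).subtype) (n+1) (by simp) (by ext x; exact x.2))
  exact this

lemma z_ker {X : ModuleCat.{u} R} (P : ProjectiveResolution X) (Y : ModuleCat.{u} R) (n : ℕ) :
    LinearMap.ker (zExt P Y (n+1)) = LinearMap.ker (zHom P Y (n+1)) := by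
  ext f
  rw [LinearMap.mem_ker, LinearMap.mem_ker]
  have hf : P.complex.d (n+1+1) (n+1) ≫ f.1 = 0 := f.2
  refine (P.extMk_eq_zero_iff f.1 (n+1+1) rfl hf n rfl).trans ?_
  set K := P.complex.linearYonedaObj R Y
  have hi : Function.Injective (K.iCycles (n+1)).hom := (ModuleCat.mono_iff_injective _).1 inferInstance
  have hl := congrArg (fun g => g.hom f) (K.liftCycles_i (A := ModuleCat.of R (ZZ P Y (n+1))) (ModuleCat.ofHom (ZZ P Y (n+1)).subtype) (n+1+1) (by simp) (by ext x; exact x.2))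
  have hex : Function.Exact (K.toCycles n (n+1)).hom (K.homologyπ (n+1)).hom := by
    have := (ShortComplex.exact_of_g_is_cokernel (S := ShortComplex.mk _ _ (K.toCycles_comp_homologyπ n (n+1))) (K.homologyIsCokernel n (n+1) (by simp)))
    exact (ShortComplex.ShortExact.moduleCat_exact_iff_function_exact _).1 this
  refine Iff.trans ?_ (hex _).symm
  constructor
  · rintro ⟨g, hg⟩
    refine ⟨g, hi ?_⟩
    refine Eq.trans ?_ hl.symm
    exact (congrArg (fun h => h.hom g) (K.toCycles_i n (n+1))).trans hg
  · rintro ⟨g, hg⟩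
    refine ⟨g, ?_⟩
    have h1 : (K.d n (n+1)).hom g = (K.iCycles (n+1)).hom ((K.toCycles n (n+1)).hom g) := (congrArg (fun h => h.hom g) (K.toCycles_i n (n+1))).symm
    exact h1.trans ((congrArg _ hg).trans hl)

/-- comparison -/
def extEq {X : ModuleCat.{u} R} (P : ProjectiveResolution X) (Y : ModuleCat.{u} R) (n : ℕ) :
    ((Ext R (ModuleCat.{u} R) (n+1)).obj (Opposite.op X)).obj Y ≃ₗ[R] Abelian.Ext.{u} X Y (n+1) :=
  (P.isoExt (n+1) Y).toLinearEquiv ≪≫ₗ ((zHom P Y (n+1)).quotKerEquivOfSurjective (zHom_surj P Y (n+1))).symm ≪≫ₗ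
   Submodule.quotEquivOfEq _ _ (z_ker P Y n).symm ≪≫ₗ ((zExt P Y (n+1)).quotKerEquivOfSurjective (zExt_surj P Y (n+1)))

lemma extEq_rep {X : ModuleCat.{u} R} (P : ProjectiveResolution X) (Y : ModuleCat.{u} R) (n : ℕ) (f : ZZ P Y (n+1)) (a) (h : (P.isoExt (n+1) Y).hom.hom a = zHom P Y (n+1) f) :
    extEq P Y n a = zExt P Y (n+1) f := by
  have : (P.isoExt (n+1) Y).toLinearEquiv a = zHom P Y (n+1) f := h
  simp only [extEq, LinearEquiv.trans_apply]
  rw [this]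
  have h2 : ((zHom P Y (n+1)).quotKerEquivOfSurjective (zHom_surj P Y (n+1))).symm (zHom P Y (n+1) f) = Submodule.Quotient.mk f := by
    rw [LinearEquiv.symm_apply_eq]; rfl
  rw [h2]; rfl

lemma extEq_nat {X X' : ModuleCat.{u} R} (g : X' ⟶ X) (P : ProjectiveResolution X)
    (P' : ProjectiveResolution X') (Y : ModuleCat.{u} R) (n : ℕ) (a) :
    extEq P' Y n ((((Ext R (ModuleCat.{u} R) (n+1)).map g.op).app Y).hom a) =
      (Abelian.Ext.mk₀ g).comp (extEq P Y n a) (zero_add _) := by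
  let φ : ProjectiveResolution.Hom P' P g := ⟨ProjectiveResolution.lift g P' P, by
    have := congrArg (fun h => h.f 0) (ProjectiveResolution.lift_commutes g P' P)
    exact this⟩
  obtain ⟨f, hf⟩ := zHom_surj P Y (n+1) ((P.isoExt (n+1) Y).hom.hom a)
  rw [extEq_rep P Y n f a hf.symm]
  have hf2 : P.complex.d (n+1+1) (n+1) ≫ f.1 = 0 := f.2
  have h1 := ProjectiveResolution.mk₀_comp_extMk f.1 (n+1+1) rfl hf2 φ
  refine Eq.trans ?_ h1.symm
  have hf' : φ.hom.f (n+1) ≫ f.1 ∈ ZZ P' Y (n+1) := by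
    change P'.complex.d (n+1+1) (n+1) ≫ φ.hom.f (n+1) ≫ f.1 = 0
    simp [← φ.hom.comm_assoc, hf2]
  refine extEq_rep P' Y n ⟨_, hf'⟩ _ ?_
  have h2 := congrArg (fun h => h.hom a) (isoExt_nat g P P' φ Y (n+1))
  refine h2.trans ?_
  change (HomologicalComplex.homologyMap (yobj φ.hom Y) (n+1)).hom ((P.isoExt (n+1) Y).hom.hom a) = _
  rw [← hf]
  simp only [zHom, LinearMap.comp_apply]
  have h3 := congrArg (fun h => h.hom (((P.complex.linearYonedaObj R Y).liftCycles (A := ModuleCat.of R (ZZ P Y (n+1))) (ModuleCat.ofHom (ZZ P Y (n+1)).subtype) (n+1+1) (by simp) (by ext x; exact x.2)).hom f)) (HomologicalComplex.homologyπ_naturality (yobj (R := R) φ.hom Y) (n+1))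
  refine h3.trans ?_
  refine congrArg (((P'.complex.linearYonedaObj R Y).homologyπ (n+1)).hom) ?_
  have hi : Function.Injective ((P'.complex.linearYonedaObj R Y).iCycles (n+1)).hom := (ModuleCat.mono_iff_injective _).1 inferInstance
  apply hi
  have h4 := congrArg (fun g => g.hom ⟨_, hf'⟩) ((P'.complex.linearYonedaObj R Y).liftCycles_i (A := ModuleCat.of R (ZZ P' Y (n+1))) (ModuleCat.ofHom (ZZ P' Y (n+1)).subtype) (n+1+1) (by simp) (by ext x; exact x.2))
  refine Eq.trans ?_ h4.symm
  have h5 := congrArg (fun h => h.hom (((P.complex.linearYonedaObj R Y).liftCycles (A := ModuleCat.of R (ZZ P Y (n+1))) (ModuleCat.ofHom (ZZ P Y (n+1)).subtype) (n+1+1) (by simp) (by ext x; exact x.2)).hom f)) (HomologicalComplex.cyclesMap_i (yobj (R := R) φ.hom Y) (n+1))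
  refine h5.trans ?_
  have h6 := congrArg (fun g => ((yobj (R := R) φ.hom Y).f (n+1)).hom (g.hom f)) ((P.complex.linearYonedaObj R Y).liftCycles_i (A := ModuleCat.of R (ZZ P Y (n+1))) (ModuleCat.ofHom (ZZ P Y (n+1)).subtype) (n+1+1) (by simp) (by ext x; exact x.2))
  exact h6

end
end LC

namespace LC
section
variable {R : Type u} [CommRing R]

/-- Ext of unbundled modules -/
abbrev EX (R : Type u) [CommRing R] (X M : Type u) [AddCommGroup X] [Module R X] [AddCommGroup M] [Module R M] (n : ℕ) :=
  Abelian.Ext.{u} (ModuleCat.of R X) (ModuleCat.of R M) n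

variable {X X' X'' M N L : Type u} [AddCommGroup X] [Module R X] [AddCommGroup X'] [Module R X'] [AddCommGroup X''] [Module R X'']
  [AddCommGroup M] [Module R M] [AddCommGroup N] [Module R N] [AddCommGroup L] [Module R L] {n : ℕ}

def pre (f : X' →ₗ[R] X) : EX R X M n →ₗ[R] EX R X' M n where
  toFun u := (Abelian.Ext.mk₀ (ModuleCat.ofHom f)).comp u (zero_add n)
  map_add' u v := by simp
  map_smul' r u := by simp

def post (g : M →ₗ[R] N) : EX R X M n →ₗ[R] EX R X N n where
  toFun u := u.comp (Abelian.Ext.mk₀ (ModuleCat.ofHom g)) (add_zero n)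
  map_add' u v := by simp
  map_smul' r u := by simp

lemma pre_post (f : X' →ₗ[R] X) (g : M →ₗ[R] N) (u : EX R X M n) : pre f (post g u) = post g (pre f u) := by
  simp [pre, post]

lemma pre_id (u : EX R X M n) : pre LinearMap.id u = u := by
  simp [pre]
lemma post_id (u : EX R X M n) : post LinearMap.id u = u := by
  simp [post]
lemma pre_pre (f : X' →ₗ[R] X) (f' : X'' →ₗ[R] X') (u : EX R X M n) : pre f' (pre f u) = pre (f ∘ₗ f') u := by
  simp only [pre, LinearMap.coe_mk, AddHom.coe_mk, ModuleCat.ofHom_comp, ← Abelian.Ext.mk₀_comp_mk₀]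
  rw [Abelian.Ext.comp_assoc_of_second_deg_zero]
lemma post_post (g : M →ₗ[R] N) (g' : N →ₗ[R] L) (u : EX R X M n) : post g' (post g u) = post (g' ∘ₗ g) u := by
  simp only [post, LinearMap.coe_mk, AddHom.coe_mk, ModuleCat.ofHom_comp, ← Abelian.Ext.mk₀_comp_mk₀]
  rw [Abelian.Ext.comp_assoc_of_third_deg_zero]
lemma pre_zero (u : EX R X M n) : pre (0 : X' →ₗ[R] X) u = 0 := by
  simp [pre]
lemma post_zero (u : EX R X M n) : post (0 : M →ₗ[R] N) u = 0 := by
  simp [post]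
lemma pre_add (f g : X' →ₗ[R] X) (u : EX R X M n) : pre (f + g) u = pre f u + pre g u := by
  have : ModuleCat.ofHom (f + g) = ModuleCat.ofHom f + ModuleCat.ofHom g := rfl
  simp only [pre, LinearMap.coe_mk, AddHom.coe_mk, this, Abelian.Ext.mk₀_add, Abelian.Ext.add_comp]
lemma pre_smul (r : R) (u : EX R X M n) : pre (r • LinearMap.id) u = r • u := by
  have : ModuleCat.ofHom (r • LinearMap.id : X →ₗ[R] X) = r • 𝟙 (ModuleCat.of R X) := rfl
  simp only [pre, LinearMap.coe_mk, AddHom.coe_mk, this, Abelian.Ext.mk₀_smul, Abelian.Ext.smul_comp, Abelian.Ext.mk₀_id_comp]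
lemma post_smul (r : R) (u : EX R X M n) : post (r • LinearMap.id) u = r • u := by
  have : ModuleCat.ofHom (r • LinearMap.id : M →ₗ[R] M) = r • 𝟙 (ModuleCat.of R M) := rfl
  simp only [post, LinearMap.coe_mk, AddHom.coe_mk, this, Abelian.Ext.mk₀_smul, Abelian.Ext.comp_smul, Abelian.Ext.comp_mk₀_id]

/-- unbundled short exact sequences -/
structure SES (f : M →ₗ[R] N) (g : N →ₗ[R] L) : Prop where
  inj : Function.Injective f
  surj : Function.Surjective g
  ex : Function.Exact f g

def SES.sc {f : M →ₗ[R] N} {g : N →ₗ[R] L} (h : SES f g) : ShortComplex (ModuleCat.{u} R) :=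
  ShortComplex.mk (ModuleCat.ofHom f) (ModuleCat.ofHom g) (by ext x; exact h.ex.apply_apply_eq_zero x)

lemma SES.se {f : M →ₗ[R] N} {g : N →ₗ[R] L} (h : SES f g) : h.sc.ShortExact :=
  ModuleCat.shortComplex_shortExact _ h.ex h.inj h.surj

def SES.cls {f : M →ₗ[R] N} {g : N →ₗ[R] L} (h : SES f g) : EX R L M 1 := h.se.extClass

def del {f : M →ₗ[R] N} {g : N →ₗ[R] L} (h : SES f g) : EX R X L n →ₗ[R] EX R X M (n+1) where
  toFun u := u.comp h.cls rfl
  map_add' u v := by simp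
  map_smul' r u := by simp

lemma pre_del {f : M →ₗ[R] N} {g : N →ₗ[R] L} (h : SES f g) (k : X' →ₗ[R] X) (u : EX R X L n) :
    pre k (del h u) = del h (pre k u) := by
  simp only [pre, del, LinearMap.coe_mk, AddHom.coe_mk]
  rw [Abelian.Ext.comp_assoc]; lia

lemma post_del {f : M →ₗ[R] N} {g : N →ₗ[R] L} (h : SES f g) (u : EX R X L n) : post f (del h u) = 0 := by
  simp only [post, del, LinearMap.coe_mk, AddHom.coe_mk]
  rw [Abelian.Ext.comp_assoc_of_third_deg_zero]
  have : h.cls.comp (Abelian.Ext.mk₀ (ModuleCat.ofHom f)) (add_zero 1) = 0 := h.se.extClass_comp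
  rw [this]; simp

lemma del_post {f : M →ₗ[R] N} {g : N →ₗ[R] L} (h : SES f g) (u : EX R X N n) : del h (post g u) = 0 := by
  simp only [post, del, LinearMap.coe_mk, AddHom.coe_mk]
  rw [Abelian.Ext.comp_assoc_of_second_deg_zero]
  have : (Abelian.Ext.mk₀ (ModuleCat.ofHom g)).comp h.cls (zero_add 1) = 0 := h.se.comp_extClass
  rw [this]; simp

lemma ex1 {f : M →ₗ[R] N} {g : N →ₗ[R] L} (h : SES f g) (u : EX R X M (n+1)) (hu : post f u = 0) : ∃ v, del h v = u :=
  Abelian.Ext.covariant_sequence_exact₁ _ h.se u hu rfl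
lemma ex2 {f : M →ₗ[R] N} {g : N →ₗ[R] L} (h : SES f g) (u : EX R X N n) (hu : post g u = 0) : ∃ v, post f v = u :=
  Abelian.Ext.covariant_sequence_exact₂ _ h.se u hu
lemma ex3 {f : M →ₗ[R] N} {g : N →ₗ[R] L} (h : SES f g) (u : EX R X L n) (hu : del h u = 0) : ∃ v, post g v = u :=
  Abelian.Ext.covariant_sequence_exact₃ _ h.se u rfl hu

/-- contravariant -/
def cdel {f : X →ₗ[R] X'} {g : X' →ₗ[R] X''} (h : SES f g) : EX R X M n →ₗ[R] EX R X'' M (n+1) where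
  toFun u := h.cls.comp u (add_comm _ _)
  map_add' u v := by simp
  map_smul' r u := by simp

lemma cdel_post {f : X →ₗ[R] X'} {g : X' →ₗ[R] X''} (h : SES f g) (k : M →ₗ[R] N) (u : EX R X M n) :
    cdel h (post k u) = post k (cdel h u) := by
  simp only [post, cdel, LinearMap.coe_mk, AddHom.coe_mk]
  rw [Abelian.Ext.comp_assoc_of_third_deg_zero]
lemma cex1 {f : X →ₗ[R] X'} {g : X' →ₗ[R] X''} (h : SES f g) (u : EX R X M n) (hu : cdel h u = 0) : ∃ v, pre f v = u :=
  Abelian.Ext.contravariant_sequence_exact₁ h.se _ u (add_comm _ _) hu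
lemma cex2 {f : X →ₗ[R] X'} {g : X' →ₗ[R] X''} (h : SES f g) (u : EX R X' M n) (hu : pre f u = 0) : ∃ v, pre g v = u :=
  Abelian.Ext.contravariant_sequence_exact₂ h.se _ u hu
lemma cex3 {f : X →ₗ[R] X'} {g : X' →ₗ[R] X''} (h : SES f g) (u : EX R X'' M (n+1)) (hu : pre g u = 0) : ∃ v, cdel h v = u :=
  Abelian.Ext.contravariant_sequence_exact₃ h.se _ u hu (add_comm _ _)

lemma inj_zero (M) [AddCommGroup M] [Module R M] (hM : Module.Injective R M) (u : EX R X M (n+1)) : u = 0 := by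
  have := (Module.injective_iff_injective_object R M).1 hM
  exact Abelian.Ext.eq_zero_of_injective u
lemma proj_zero [Module.Projective R X] (u : EX R X M (n+1)) : u = 0 := by
  have : Projective (ModuleCat.of R X) := inferInstance
  exact Abelian.Ext.eq_zero_of_projective u
lemma exists_hom (u : EX R X M 0) : ∃ f : X →ₗ[R] M, u = Abelian.Ext.mk₀ (ModuleCat.ofHom f) := by
  obtain ⟨f, rfl⟩ := (Abelian.Ext.mk₀_bijective _ _).2 u
  exact ⟨f.hom, rfl⟩
lemma pre_hom (k : X' →ₗ[R] X) (f : X →ₗ[R] M) : pre k (Abelian.Ext.mk₀ (ModuleCat.ofHom f)) = Abelian.Ext.mk₀ (ModuleCat.ofHom (f ∘ₗ k)) := by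
  simp [pre]
end
end LC

namespace LC
section
variable {R : Type u} [CommRing R]

/-- index set: ideals containing a power of `J`, reversed -/
def Sx (J : Ideal R) : Type u := {I : Ideal R // ∃ t : ℕ, J ^ t ≤ I}

instance (J : Ideal R) : Preorder (Sx J) where
  le a b := b.1 ≤ a.1
  le_refl a := le_refl a.1
  le_trans a b c h h' := le_trans h' h

instance (J : Ideal R) : Nonempty (Sx J) := ⟨⟨⊤, 0, le_top⟩⟩

lemma inf_mem {J I I' : Ideal R} (h : ∃ t : ℕ, J ^ t ≤ I) (h' : ∃ t : ℕ, J ^ t ≤ I') : ∃ t : ℕ, J ^ t ≤ I ⊓ I' := by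
  obtain ⟨t, ht⟩ := h
  obtain ⟨s, hs⟩ := h'
  exact ⟨t + s, le_inf ((Ideal.pow_le_pow_right (by lia)).trans ht) ((Ideal.pow_le_pow_right (by lia)).trans hs)⟩

instance (J : Ideal R) : IsDirectedOrder (Sx J) :=
  ⟨fun a b => ⟨⟨a.1 ⊓ b.1, inf_mem a.2 b.2⟩, (inf_le_left : a.1 ⊓ b.1 ≤ a.1), (inf_le_right : a.1 ⊓ b.1 ≤ b.1)⟩⟩

instance (J : Ideal R) : DecidableEq (Sx J) := Classical.decEq _

variable {M N L : Type u} [AddCommGroup M] [Module R M] [AddCommGroup N] [Module R N] [AddCommGroup L] [Module R L] {n : ℕ}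

abbrev qm {I I' : Ideal R} (h : I ≤ I') : (R ⧸ I) →ₗ[R] (R ⧸ I') := Submodule.factor h

lemma qm_comp {I I' I'' : Ideal R} (h : I ≤ I') (h' : I' ≤ I'') : qm h' ∘ₗ qm h = qm (h.trans h') := by
  ext; rfl
lemma qm_id {I : Ideal R} (h : I ≤ I) : qm h = LinearMap.id := by
  ext; rfl

def fH (J : Ideal R) (n : ℕ) (M : Type u) [AddCommGroup M] [Module R M] :
    ∀ i j : Sx J, i ≤ j → EX R (R ⧸ i.1) M n →ₗ[R] EX R (R ⧸ j.1) M n :=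
  fun _ _ h => pre (qm h)

instance (J : Ideal R) (n : ℕ) (M : Type u) [AddCommGroup M] [Module R M] :
    DirectedSystem (fun i : Sx J => EX R (R ⧸ i.1) M n) (fun i j h => fH J n M i j h) where
  map_self i x := by
    simp only [fH]; rw [qm_id, pre_id]
  map_map i j k h h' x := by
    simp only [fH]; rw [pre_pre, qm_comp]

/-- local cohomology, concretely -/
def H (J : Ideal R) (n : ℕ) (M : Type u) [AddCommGroup M] [Module R M] : Type u :=
  Module.DirectLimit (fun i : Sx J => EX R (R ⧸ i.1) M n) (fH J n M)

instance (J : Ideal R) : AddCommGroup (H J n M) := inferInstanceAs (AddCommGroup (Module.DirectLimit _ _))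
instance (J : Ideal R) : Module R (H J n M) := inferInstanceAs (Module R (Module.DirectLimit _ _))

def of (J : Ideal R) (n : ℕ) (M : Type u) [AddCommGroup M] [Module R M] (I : Ideal R) (hI : ∃ t : ℕ, J ^ t ≤ I) : EX R (R ⧸ I) M n →ₗ[R] H J n M :=
  Module.DirectLimit.of R (Sx J) (fun i : Sx J => EX R (R ⧸ i.1) M n) (fH J n M) ⟨I, hI⟩

lemma of_res {J I I' : Ideal R} (hI : ∃ t : ℕ, J ^ t ≤ I) (hI' : ∃ t : ℕ, J ^ t ≤ I') (h : I ≤ I') (u : EX R (R ⧸ I') M n) :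
    of J n M I hI (pre (qm h) u) = of J n M I' hI' u :=
  Module.DirectLimit.of_f (f := fH J n M) (i := ⟨I', hI'⟩) (j := ⟨I, hI⟩) (hij := h)

lemma exists_of {J : Ideal R} (x : H J n M) : ∃ I hI u, of J n M I hI u = x := by
  obtain ⟨i, u, h⟩ := Module.DirectLimit.exists_of x
  exact ⟨i.1, i.2, u, h⟩

lemma of_zero {J I : Ideal R} (hI : ∃ t : ℕ, J ^ t ≤ I) (u : EX R (R ⧸ I) M n) (h : of J n M I hI u = 0) :
    ∃ I' , ∃ _ : ∃ t : ℕ, J ^ t ≤ I', ∃ h : I' ≤ I, pre (qm h) u = 0 := by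
  obtain ⟨j, hj, e⟩ := Module.DirectLimit.of.zero_exact h
  exact ⟨j.1, j.2, hj, e⟩

def lft {J : Ideal R} {P : Type*} [AddCommGroup P] [Module R P] (g : ∀ I : Ideal R, (∃ t : ℕ, J ^ t ≤ I) → EX R (R ⧸ I) M n →ₗ[R] P)
    (hg : ∀ I hI I' hI' (h : I ≤ I') u, g I hI (pre (qm h) u) = g I' hI' u) : H J n M →ₗ[R] P :=
  Module.DirectLimit.lift R (Sx J) _ (fH J n M) (fun i => g i.1 i.2) (fun i j hij x => hg _ _ _ _ _ _)

lemma lft_of {J : Ideal R} {P : Type*} [AddCommGroup P] [Module R P] (g : ∀ I : Ideal R, (∃ t : ℕ, J ^ t ≤ I) → EX R (R ⧸ I) M n →ₗ[R] P)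
    (hg : ∀ I hI I' hI' (h : I ≤ I') u, g I hI (pre (qm h) u) = g I' hI' u) (I hI u) : lft g hg (of J n M I hI u) = g I hI u :=
  Module.DirectLimit.lift_of (f := fH J n M) _ _ _

def map (J : Ideal R) (n : ℕ) (f : M →ₗ[R] N) : H J n M →ₗ[R] H J n N :=
  lft (fun I hI => of J n N I hI ∘ₗ post f) (fun I hI I' hI' h u => by
    simp only [LinearMap.comp_apply]; rw [← pre_post, of_res])

lemma map_of {J : Ideal R} (f : M →ₗ[R] N) (I hI u) : map J n f (of J n M I hI u) = of J n N I hI (post f u) :=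
  lft_of _ _ _ _ _

def chg (n : ℕ) (M : Type u) [AddCommGroup M] [Module R M] {a b : Ideal R} (h : b ≤ a) : H a n M →ₗ[R] H b n M :=
  lft (fun I hI => of b n M I (hI.imp fun t ht => (Ideal.pow_right_mono h t).trans ht)) (fun I hI I' hI' h u => by
    rw [of_res])

lemma chg_of {a b : Ideal R} (h : b ≤ a) (I hI hI' u) : chg n M h (of a n M I hI u) = of b n M I hI' u :=
  lft_of _ _ _ _ _

def dl (J : Ideal R) {n : ℕ} {f : M →ₗ[R] N} {g : N →ₗ[R] L} (h : SES f g) : H J n L →ₗ[R] H J (n+1) M :=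
  lft (fun I hI => of J (n+1) M I hI ∘ₗ del h) (fun I hI I' hI' _ u => by
    simp only [LinearMap.comp_apply]; rw [← pre_del, of_res])

lemma dl_of {J : Ideal R} {f : M →ₗ[R] N} {g : N →ₗ[R] L} (h : SES f g) (I hI u) : dl J h (of J n L I hI u) = of J (n+1) M I hI (del h u) :=
  lft_of _ _ _ _ _

lemma map_id' {J : Ideal R} (x : H J n M) : map J n LinearMap.id x = x := by
  obtain ⟨I, hI, u, rfl⟩ := exists_of x
  rw [map_of, post_id]
lemma map_map' {J : Ideal R} (f : M →ₗ[R] N) (g : N →ₗ[R] L) (x : H J n M) : map J n g (map J n f x) = map J n (g ∘ₗ f) x := by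
  obtain ⟨I, hI, u, rfl⟩ := exists_of x
  rw [map_of, map_of, map_of, post_post]
lemma map_zero' {J : Ideal R} (x : H J n M) : map J n (0 : M →ₗ[R] N) x = 0 := by
  obtain ⟨I, hI, u, rfl⟩ := exists_of x
  rw [map_of, post_zero, map_zero]
lemma map_smul' {J : Ideal R} (r : R) (x : H J n M) : map J n (r • LinearMap.id) x = r • x := by
  obtain ⟨I, hI, u, rfl⟩ := exists_of x
  rw [map_of, post_smul, _root_.map_smul]
lemma chg_map {a b : Ideal R} (h : b ≤ a) (f : M →ₗ[R] N) (x : H a n M) : chg n N h (map a n f x) = map b n f (chg n M h x) := by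
  obtain ⟨I, hI, u, rfl⟩ := exists_of x
  rw [map_of, chg_of, chg_of, map_of]
  exact (hI.imp fun t ht => (Ideal.pow_right_mono h t).trans ht)
lemma chg_dl {a b : Ideal R} (hab : b ≤ a) {f : M →ₗ[R] N} {g : N →ₗ[R] L} (h : SES f g) (x : H a n L) :
    chg (n+1) M hab (dl a h x) = dl b h (chg n L hab x) := by
  obtain ⟨I, hI, u, rfl⟩ := exists_of x
  rw [dl_of, chg_of, chg_of, dl_of]
  exact (hI.imp fun t ht => (Ideal.pow_right_mono hab t).trans ht)
lemma chg_chg {a b c : Ideal R} (h : b ≤ a) (h' : c ≤ b) (x : H a n M) : chg n M h' (chg n M h x) = chg n M (h'.trans h) x := by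
  obtain ⟨I, hI, u, rfl⟩ := exists_of x
  have hb := (hI.imp fun t ht => (Ideal.pow_right_mono h t).trans ht)
  have hc := (hb.imp fun t ht => (Ideal.pow_right_mono h' t).trans ht)
  rw [chg_of h I hI hb, chg_of h' I hb hc, chg_of _ I hI hc]

lemma map_dl {J : Ideal R} {f : M →ₗ[R] N} {g : N →ₗ[R] L} (h : SES f g) (x : H J n L) : map J (n+1) f (dl J h x) = 0 := by
  obtain ⟨I, hI, u, rfl⟩ := exists_of x
  rw [dl_of, map_of, post_del, map_zero]
lemma dl_map {J : Ideal R} {f : M →ₗ[R] N} {g : N →ₗ[R] L} (h : SES f g) (x : H J n N) : dl J h (map J n g x) = 0 := by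
  obtain ⟨I, hI, u, rfl⟩ := exists_of x
  rw [map_of, dl_of, del_post, map_zero]
lemma map_map0 {J : Ideal R} {f : M →ₗ[R] N} {g : N →ₗ[R] L} (h : SES f g) (x : H J n M) : map J n g (map J n f x) = 0 := by
  rw [map_map']
  have : g ∘ₗ f = 0 := by ext x; exact h.ex.apply_apply_eq_zero x
  rw [this, map_zero']

lemma hex1 {J : Ideal R} {f : M →ₗ[R] N} {g : N →ₗ[R] L} (h : SES f g) (x : H J (n+1) M) (hx : map J (n+1) f x = 0) : ∃ y, dl J h y = x := by
  obtain ⟨I, hI, u, rfl⟩ := exists_of x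
  rw [map_of] at hx
  obtain ⟨I', hI', hl, e⟩ := of_zero _ _ hx
  rw [pre_post] at e
  obtain ⟨v, hv⟩ := ex1 h _ e
  exact ⟨of J n L I' hI' v, by rw [dl_of, hv, of_res]⟩
lemma hex2 {J : Ideal R} {f : M →ₗ[R] N} {g : N →ₗ[R] L} (h : SES f g) (x : H J n N) (hx : map J n g x = 0) : ∃ y, map J n f y = x := by
  obtain ⟨I, hI, u, rfl⟩ := exists_of x
  rw [map_of] at hx
  obtain ⟨I', hI', hl, e⟩ := of_zero _ _ hx
  rw [pre_post] at e
  obtain ⟨v, hv⟩ := ex2 h _ e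
  exact ⟨of J n M I' hI' v, by rw [map_of, hv, of_res]⟩
lemma hex3 {J : Ideal R} {f : M →ₗ[R] N} {g : N →ₗ[R] L} (h : SES f g) (x : H J n L) (hx : dl J h x = 0) : ∃ y, map J n g y = x := by
  obtain ⟨I, hI, u, rfl⟩ := exists_of x
  rw [dl_of] at hx
  obtain ⟨I', hI', hl, e⟩ := of_zero _ _ hx
  rw [pre_del] at e
  obtain ⟨v, hv⟩ := ex3 h _ e
  exact ⟨of J n N I' hI' v, by rw [map_of, hv, of_res]⟩

lemma ext_smul {I : Ideal R} (u : EX R (R ⧸ I) M n) (r : R) (hr : r ∈ I) : r • u = 0 := by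
  rw [← pre_smul]
  have : (r • LinearMap.id : (R ⧸ I) →ₗ[R] (R ⧸ I)) = 0 := by
    ext
    change Submodule.Quotient.mk (r • 1) = (Submodule.Quotient.mk 0 : R ⧸ I)
    rw [Submodule.Quotient.eq]; simpa using hr
  rw [this, pre_zero]

lemma tors {J : Ideal R} (x : H J n M) : ∃ t : ℕ, ∀ r ∈ J ^ t, r • x = 0 := by
  obtain ⟨I, hI, u, rfl⟩ := exists_of x
  obtain ⟨t, ht⟩ := hI
  refine ⟨t, fun r hr => ?_⟩
  rw [← _root_.map_smul, ext_smul _ _ (ht hr), map_zero]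

lemma smul_zero_of {J : Ideal R} (r : R) (h : ∀ m : M, r • m = 0) (x : H J n M) : r • x = 0 := by
  rw [← map_smul']
  have : (r • LinearMap.id : M →ₗ[R] M) = 0 := by ext m; exact h m
  rw [this, map_zero']

lemma H_top (x : H (⊤ : Ideal R) n M) : x = 0 := by
  obtain ⟨t, ht⟩ := tors x
  have := ht 1 (by rw [Ideal.top_pow]; exact Submodule.mem_top)
  simpa using this
end
end LC

namespace LC
section
variable {R : Type u} [CommRing R]
open Limits Opposite localCohomology

/-- bridge -/
theorem bridge (J : Ideal R) (n : ℕ) (M : Type u) [AddCommGroup M] [Module R M] :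
    Nonempty (((localCohomology J (n+1)).obj (ModuleCat.of R M)) ≃ₗ[R] H J (n+1) M) := by
  let F := diagram (idealPowersDiagram J) (n+1)
  let Y := ModuleCat.of R M
  let G : ℕᵒᵖᵒᵖ ⥤ ModuleCat.{u} R := F ⋙ (evaluation _ _).obj Y
  let e1 : (localCohomology J (n+1)).obj Y ≅ colimit G := colimitObjIsoColimitCompEvaluation F Y
  have pr : ∀ X : ModuleCat.{u} R, ProjectiveResolution X := fun X => projectiveResolution X
  let c : Cocone G :=
    { pt := ModuleCat.of R (H J (n+1) M)
      ι := { app := fun t => ModuleCat.ofHom ((of J (n+1) M (J ^ (unop (unop t))) ⟨_, le_rfl⟩) ∘ₗ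
                (extEq (pr _) Y n).toLinearMap)
             naturality := by
              intro t s w
              ext a
              have h1 := extEq_nat ((ringModIdeals (idealPowersDiagram J)).map w.unop) (pr _) (pr _) Y n a
              refine (congrArg (of J (n+1) M _ _) h1).trans ?_
              refine of_res _ _ (Ideal.pow_le_pow_right w.unop.unop.down.down) (extEq (pr _) Y n a) } }
  have hbij : Function.Bijective (colimit.desc G c).hom := by
    constructor
    · rw [← LinearMap.ker_eq_bot, LinearMap.ker_eq_bot']
      intro z hz
      have ipf : PreservesFilteredColimitsOfSize.{0,0} (forget (ModuleCat.{u} R)) := preservesFilteredColimitsOfSize_shrink.{0,u,0,u} _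
      have ipc : PreservesColimit G (forget (ModuleCat.{u} R)) := (ipf.preserves_filtered_colimits ℕᵒᵖᵒᵖ).preservesColimit
      obtain ⟨t, a, rfl⟩ := Concrete.colimit_exists_rep G z
      have h1 := congrArg (fun h => h.hom a) (colimit.ι_desc c t)
      have h2 : of J (n+1) M (J ^ (unop (unop t))) ⟨_, le_rfl⟩ (extEq (pr _) Y n a) = 0 := h1.symm.trans hz
      obtain ⟨I', ⟨s, hs⟩, hl, e⟩ := of_zero _ _ h2
      let w : s + unop (unop t) ≥ unop (unop t) := by lia
      let w' : t ⟶ op (op (s + unop (unop t))) := (homOfLE w).op.op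
      have h3 := extEq_nat ((ringModIdeals (idealPowersDiagram J)).map w'.unop) (pr _) (pr _) Y n a
      have h4 : (G.map w').hom a = 0 := by
        apply (extEq (pr _) Y n).injective
        refine Eq.trans ?_ (LinearEquiv.map_zero _).symm
        refine h3.trans ?_
        have hq : J ^ (s + unop (unop t)) ≤ I' := (Ideal.pow_le_pow_right (by lia)).trans hs
        have : pre (qm hq) (pre (qm hl) (extEq (pr _) Y n a)) = 0 := by rw [e, map_zero]
        rw [pre_pre, qm_comp] at this
        exact this
      have h5 := congrArg (fun h => h.hom a) (colimit.w G w')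
      refine h5.symm.trans ?_
      change (colimit.ι G _).hom ((G.map w').hom a) = 0
      rw [h4, map_zero]
    · intro x
      obtain ⟨I, ⟨t, ht⟩, u, rfl⟩ := exists_of x
      refine ⟨(colimit.ι G (op (op t))).hom ((extEq (pr _) Y n).symm (pre (qm ht) u)), ?_⟩
      have h1 := congrArg (fun h => h.hom ((extEq (pr _) Y n).symm (pre (qm ht) u))) (colimit.ι_desc c (op (op t)))
      refine h1.trans ?_
      refine (congrArg (of J (n+1) M _ _) (LinearEquiv.apply_symm_apply _ _)).trans ?_
      exact of_res _ _ _ _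
  exact ⟨e1.toLinearEquiv ≪≫ₗ LinearEquiv.ofBijective _ hbij⟩
end
end LC

namespace LC
section
variable {R : Type u} [CommRing R]
variable {X M N L : Type u} [AddCommGroup X] [Module R X] [AddCommGroup M] [Module R M] [AddCommGroup N] [Module R N] [AddCommGroup L] [Module R L] {n : ℕ}

/-- `a`-power torsion -/
def Tor (a : Ideal R) (M : Type u) [AddCommGroup M] [Module R M] : Prop :=
  ∀ m : M, ∃ t : ℕ, ∀ r ∈ a ^ t, r • m = 0

lemma fg_kill {a : Ideal R} (hM : Tor a M) [Module.Finite R X] (f : X →ₗ[R] M) :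
    ∃ s : ℕ, ∀ r ∈ a ^ s, ∀ x, r • f x = 0 := by
  obtain ⟨S, hS⟩ := Module.Finite.fg_top (R := R) (M := X)
  choose t ht using fun x : X => hM (f x)
  refine ⟨S.sup t, fun r hr x => ?_⟩
  have hx : x ∈ Submodule.span R (S : Set X) := hS ▸ Submodule.mem_top
  induction hx using Submodule.span_induction with
  | mem y hy => exact ht y r (Ideal.pow_le_pow_right (Finset.le_sup hy) hr)
  | zero => simp
  | add y z _ _ h1 h2 => simp [h1, h2]
  | smul c y _ h => rw [map_smul, smul_comm, h, smul_zero]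

/-- torsion submodule -/
def gam (a : Ideal R) (M : Type u) [AddCommGroup M] [Module R M] : Submodule R M where
  carrier := {m | ∃ t : ℕ, ∀ r ∈ a ^ t, r • m = 0}
  zero_mem' := ⟨0, by simp⟩
  add_mem' := by
    rintro x y ⟨t, ht⟩ ⟨s, hs⟩
    refine ⟨t + s, fun r hr => ?_⟩
    rw [smul_add, ht r (Ideal.pow_le_pow_right (by lia) hr), hs r (Ideal.pow_le_pow_right (by lia) hr), add_zero]
  smul_mem' := by
    rintro c x ⟨t, ht⟩
    exact ⟨t, fun r hr => by rw [smul_comm, ht r hr, smul_zero]⟩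

lemma tor_gam (a : Ideal R) : Tor a (gam a M) := by
  rintro ⟨m, t, ht⟩
  exact ⟨t, fun r hr => Subtype.ext (ht r hr)⟩

lemma tor_of_surj {a : Ideal R} (f : M →ₗ[R] N) (hf : Function.Surjective f) (h : Tor a M) : Tor a N := by
  intro y
  obtain ⟨x, rfl⟩ := hf y
  obtain ⟨t, ht⟩ := h x
  exact ⟨t, fun r hr => by rw [← map_smul, ht r hr, map_zero]⟩

lemma exists_injective (M : Type u) [AddCommGroup M] [Module R M] :
    ∃ (E : Type u) (_ : AddCommGroup E) (_ : Module R E) (f : M →ₗ[R] E), Module.Injective R E ∧ Function.Injective f := by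
  obtain ⟨p⟩ := EnoughInjectives.presentation (ModuleCat.of R M)
  have h := p.injective
  refine ⟨p.J, inferInstance, inferInstance, p.f.hom, ?_, (ModuleCat.mono_iff_injective p.f).1 p.mono⟩
  exact (Module.injective_iff_injective_object R p.J).2 h

lemma artin_rees [IsNoetherianRing R] (a I : Ideal R) (s : ℕ) : ∃ N : ℕ, a ^ N ⊓ I ≤ a ^ s * I := by
  obtain ⟨k, hk⟩ := Ideal.exists_pow_inf_eq_pow_smul (M := R) a I
  refine ⟨k + s, ?_⟩
  have := hk (k + s) (by lia)
  simp only [smul_eq_mul, Ideal.mul_top, Nat.add_sub_cancel_left] at this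
  rw [this]
  exact Ideal.mul_mono_right inf_le_right

lemma gam_injective [IsNoetherianRing R] (a : Ideal R) (E : Type u) [AddCommGroup E] [Module R E] (hE : Module.Injective R E) :
    Module.Injective R (gam a E) := by
  apply Module.Baer.injective
  intro I g
  obtain ⟨s, hs⟩ := fg_kill (tor_gam (M := E) a) g
  obtain ⟨N, hN⟩ := artin_rees a I s
  let q : I →ₗ[R] (R ⧸ (a ^ N)) := (a ^ N).mkQ ∘ₗ I.subtype
  have hq : LinearMap.ker q ≤ LinearMap.ker ((gam a E).subtype ∘ₗ g) := by
    rintro ⟨x, hx⟩ hxq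
    have hxN : x ∈ a ^ N := by
      exact (Submodule.Quotient.mk_eq_zero (a ^ N)).1 hxq
    have hx2 := hN ⟨hxN, hx⟩
    have key : ∀ y (hy : y ∈ a ^ s * I), ∃ hy' : y ∈ I, g ⟨y, hy'⟩ = 0 := by
      intro y hy
      induction hy using Submodule.mul_induction_on' with
      | mem_mul_mem r hr i hi =>
        refine ⟨I.mul_mem_left r hi, ?_⟩
        have := hs r hr ⟨i, hi⟩
        rw [← map_smul] at this
        exact this
      | add x _ y _ h1 h2 =>
        obtain ⟨h1, e1⟩ := h1
        obtain ⟨h2, e2⟩ := h2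
        refine ⟨I.add_mem h1 h2, ?_⟩
        have : (⟨x + y, I.add_mem h1 h2⟩ : I) = ⟨x, h1⟩ + ⟨y, h2⟩ := rfl
        rw [this, map_add, e1, e2, add_zero]
    obtain ⟨_, e⟩ := key x hx2
    simp [LinearMap.mem_ker, e]
  obtain ⟨h, hh⟩ := hE.out ((LinearMap.ker q).liftQ q le_rfl) (by
    rw [← LinearMap.ker_eq_bot, Submodule.ker_liftQ_eq_bot']; rfl) ((LinearMap.ker q).liftQ _ hq)
  refine ⟨LinearMap.codRestrict (gam a E) (h ∘ₗ (a ^ N).mkQ) (fun x => ⟨N, fun r hr => ?_⟩), ?_⟩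
  · rw [← map_smul]
    have : r • x ∈ a ^ N := Ideal.mul_mem_right _ _ hr
    have h0 : (a ^ N).mkQ (r • x) = 0 := (Submodule.Quotient.mk_eq_zero (a ^ N)).2 this
    simp only [LinearMap.comp_apply, h0, map_zero]
  · intro x hx
    apply Subtype.ext
    have := hh (Submodule.Quotient.mk ⟨x, hx⟩)
    exact this

lemma exists_tor_injective [IsNoetherianRing R] (a : Ideal R) (hM : Tor a M) :
    ∃ (E : Type u) (_ : AddCommGroup E) (_ : Module R E) (f : M →ₗ[R] E), Module.Injective R E ∧ Function.Injective f ∧ Tor a E := by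
  obtain ⟨E, _, _, f, hE, hf⟩ := exists_injective (R := R) M
  refine ⟨gam a E, inferInstance, inferInstance, f.codRestrict _ (fun m => ?_), gam_injective a E hE, ?_, tor_gam a⟩
  · obtain ⟨t, ht⟩ := hM m
    exact ⟨t, fun r hr => by rw [← map_smul, ht r hr, map_zero]⟩
  · intro x y h
    exact hf (congrArg Subtype.val h)

lemma ses_coker {f : M →ₗ[R] N} (hf : Function.Injective f) : SES f (LinearMap.range f).mkQ :=
  ⟨hf, Submodule.mkQ_surjective _, by
    rw [LinearMap.exact_iff]; simp⟩

lemma ses_sub (K : Submodule R M) : SES K.subtype K.mkQ :=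
  ⟨Subtype.val_injective, Submodule.mkQ_surjective _, by rw [LinearMap.exact_iff]; simp⟩

lemma T1 [IsNoetherianRing R] {a : Ideal R} (hM : Tor a M) [Module.Finite R X] (u : EX R X M n) :
    ∃ s : ℕ, pre ((a ^ s • (⊤ : Submodule R X)).subtype) u = 0 := by
  induction n generalizing M with
  | zero =>
    obtain ⟨f, rfl⟩ := exists_hom u
    obtain ⟨s, hs⟩ := fg_kill hM f
    refine ⟨s, ?_⟩
    rw [pre_hom]
    have : f ∘ₗ (a ^ s • (⊤ : Submodule R X)).subtype = 0 := by
      ext ⟨x, hx⟩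
      simp only [LinearMap.comp_apply, Submodule.subtype_apply, LinearMap.zero_apply]
      induction hx using Submodule.smul_induction_on' with
      | smul r hr y hy => rw [map_smul]; exact hs r hr y
      | add x _ y _ h1 h2 => rw [map_add, h1, h2, add_zero]
    rw [this]
    exact Abelian.Ext.mk₀_zero (ModuleCat.of R _) (ModuleCat.of R _)
  | succ j ih =>
    obtain ⟨E, _, _, f, hE, hf, hT⟩ := exists_tor_injective a hM
    obtain ⟨v, rfl⟩ := ex1 (ses_coker hf) u (inj_zero E hE _)
    obtain ⟨s, hs⟩ := ih (tor_of_surj _ (Submodule.mkQ_surjective _) hT) v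
    exact ⟨s, by rw [pre_del, hs, map_zero]⟩

lemma H_inj_zero {J : Ideal R} (hM : Module.Injective R M) (x : H J (n+1) M) : x = 0 := by
  obtain ⟨I, hI, u, rfl⟩ := exists_of x
  rw [inj_zero M hM u, map_zero]

lemma H_tor_zero [IsNoetherianRing R] {a : Ideal R} (hM : Tor a M) (x : H a (n+1) M) : x = 0 := by
  induction n generalizing M with
  | zero =>
    obtain ⟨E, _, _, f, hE, hf, hT⟩ := exists_tor_injective a hM
    obtain ⟨y, rfl⟩ := hex1 (ses_coker hf) x (H_inj_zero hE _)
    obtain ⟨I, hI, u, rfl⟩ := exists_of y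
    obtain ⟨g, rfl⟩ := exists_hom u
    obtain ⟨e, he⟩ := Submodule.mkQ_surjective _ (g (Submodule.Quotient.mk 1))
    obtain ⟨t, ht⟩ := hT e
    have hI' := inf_mem hI ⟨t, le_refl (a ^ t)⟩
    have hk : I ⊓ a ^ t ≤ LinearMap.ker (LinearMap.toSpanSingleton R E e) := by
      intro r hr
      exact ht r hr.2
    let k : (R ⧸ (I ⊓ a ^ t)) →ₗ[R] E := Submodule.liftQ _ (LinearMap.toSpanSingleton R E e) hk
    have : g ∘ₗ qm (inf_le_left : I ⊓ a ^ t ≤ I) = (LinearMap.range f).mkQ ∘ₗ k := by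
      ext
      change g (Submodule.Quotient.mk 1) = (LinearMap.range f).mkQ ((1:R) • e)
      rw [one_smul, he]
    rw [← of_res hI' hI inf_le_left, pre_hom, this]
    have h2 : of a 0 (E ⧸ LinearMap.range f) (I ⊓ a^t) hI' (Abelian.Ext.mk₀ (ModuleCat.ofHom ((LinearMap.range f).mkQ ∘ₗ k))) =
       map a 0 (LinearMap.range f).mkQ (of a 0 E _ hI' (Abelian.Ext.mk₀ (ModuleCat.ofHom k))) := by
      rw [map_of]; simp [post]
    rw [h2, dl_map]
  | succ j ih =>
    obtain ⟨E, _, _, f, hE, hf, hT⟩ := exists_tor_injective a hM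
    obtain ⟨y, rfl⟩ := hex1 (ses_coker hf) x (H_inj_zero hE _)
    rw [ih (tor_of_surj _ (Submodule.mkQ_surjective _) hT) y, map_zero]

end
end LC

namespace LC
section
variable {R : Type u} [CommRing R]
variable {M : Type u} [AddCommGroup M] [Module R M] {n : ℕ}

def mvf (I J : Ideal R) : (R ⧸ (I ⊓ J)) →ₗ[R] (R ⧸ I) × (R ⧸ J) := (qm inf_le_left).prod (qm inf_le_right)
def mvg (I J : Ideal R) : (R ⧸ I) × (R ⧸ J) →ₗ[R] (R ⧸ (I ⊔ J)) := (qm le_sup_left).coprod (-(qm le_sup_right))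

lemma mv_ses (I J : Ideal R) : SES (mvf I J) (mvg I J) := by
  refine ⟨?_, ?_, ?_⟩
  · rw [injective_iff_map_eq_zero]
    intro x hx
    obtain ⟨r, rfl⟩ := (I ⊓ J).mkQ_surjective x
    have h1 : I.mkQ r = 0 := congrArg Prod.fst hx
    have h2 : J.mkQ r = 0 := congrArg Prod.snd hx
    exact (Submodule.Quotient.mk_eq_zero _).2 ⟨(Submodule.Quotient.mk_eq_zero I).1 h1, (Submodule.Quotient.mk_eq_zero J).1 h2⟩
  · intro x
    obtain ⟨r, rfl⟩ := (I ⊔ J).mkQ_surjective x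
    refine ⟨(I.mkQ r, 0), ?_⟩
    simp only [mvg, LinearMap.coprod_apply, map_zero, add_zero]
    rfl
  · intro x
    obtain ⟨x, y⟩ := x
    obtain ⟨r, rfl⟩ := I.mkQ_surjective x
    obtain ⟨s, rfl⟩ := J.mkQ_surjective y
    have key : mvg I J (I.mkQ r, J.mkQ s) = (I ⊔ J).mkQ (r - s) := by
      rw [map_sub, sub_eq_add_neg]; rfl
    rw [key]
    constructor
    · intro h
      have := (Submodule.Quotient.mk_eq_zero (I ⊔ J)).1 h
      obtain ⟨i, hi, j, hj, e⟩ := Submodule.mem_sup.1 this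
      refine ⟨(I ⊓ J).mkQ (r - i), ?_⟩
      refine Prod.ext ?_ ?_
      · exact (Submodule.Quotient.eq I).2 (by simpa using hi)
      · refine (Submodule.Quotient.eq J).2 ?_
        have : r - i - s = j := by linear_combination -e
        exact this.symm ▸ hj
    · rintro ⟨z, hz⟩
      obtain ⟨t, rfl⟩ := (I ⊓ J).mkQ_surjective z
      have h1 : I.mkQ t = I.mkQ r := congrArg Prod.fst hz
      have h2 : J.mkQ t = J.mkQ s := congrArg Prod.snd hz
      have h1 := (Submodule.Quotient.eq I).1 h1
      have h2 := (Submodule.Quotient.eq J).1 h2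
      refine (Submodule.Quotient.mk_eq_zero (I ⊔ J)).2 ?_
      have : r - s = -(t - r) + (t - s) := by ring
      rw [this]
      exact add_mem (neg_mem (Ideal.mem_sup_left h1)) (Ideal.mem_sup_right h2)

lemma mv_glue {I J : Ideal R} (u : EX R (R ⧸ I) M n) (v : EX R (R ⧸ J) M n)
    (h : pre (qm (inf_le_left : I ⊓ J ≤ I)) u = pre (qm (inf_le_right : I ⊓ J ≤ J)) v) :
    ∃ w : EX R (R ⧸ (I ⊔ J)) M n, pre (qm le_sup_left) w = u ∧ pre (qm le_sup_right) w = v := by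
  have h0 : pre (mvf I J) (pre (LinearMap.fst R (R ⧸ I) (R ⧸ J)) u - pre (LinearMap.snd R (R ⧸ I) (R ⧸ J)) v) = 0 := by
    rw [map_sub, pre_pre, pre_pre, sub_eq_zero]
    exact h
  obtain ⟨w, hw⟩ := cex2 (mv_ses I J) _ h0
  refine ⟨w, ?_, ?_⟩
  · have := congrArg (pre (LinearMap.inl R (R ⧸ I) (R ⧸ J))) hw
    rw [map_sub, pre_pre, pre_pre, pre_pre, LinearMap.fst_comp_inl, LinearMap.snd_comp_inl, pre_zero, sub_zero, pre_id, mvg, LinearMap.coprod_inl] at this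
    exact this
  · have := congrArg (pre (LinearMap.inr R (R ⧸ I) (R ⧸ J))) hw
    rw [map_sub, pre_pre, pre_pre, pre_pre, LinearMap.fst_comp_inr, LinearMap.snd_comp_inr, pre_zero, zero_sub, pre_id, mvg, LinearMap.coprod_inr] at this
    have e : pre (-(qm (le_sup_right : J ≤ I ⊔ J))) w = - pre (qm (le_sup_right : J ≤ I ⊔ J)) w := by
      rw [eq_neg_iff_add_eq_zero, ← pre_add, neg_add_cancel, pre_zero]
    rw [e] at this
    exact neg_injective this

lemma MV [IsNoetherianRing R] (a b : Ideal R) (h0 : ∀ z : H (a ⊓ b) n M, z = 0) (x : H a n M) (y : H b n M) :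
    ∃ w : H (a ⊔ b) n M, chg n M le_sup_left w = x ∧ chg n M le_sup_right w = y := by
  obtain ⟨I, ⟨i, hi⟩, u, rfl⟩ := exists_of x
  obtain ⟨J, ⟨j, hj⟩, v, rfl⟩ := exists_of y
  have hIJ : ∃ t : ℕ, (a ⊓ b) ^ t ≤ I ⊓ J :=
    inf_mem ⟨i, (Ideal.pow_right_mono inf_le_left i).trans hi⟩ ⟨j, (Ideal.pow_right_mono inf_le_right j).trans hj⟩
  obtain ⟨T, ⟨s, hs⟩, hT, e⟩ := of_zero hIJ (pre (qm (inf_le_left : I ⊓ J ≤ I)) u - pre (qm (inf_le_right : I ⊓ J ≤ J)) v) (h0 _)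
  obtain ⟨N, hN⟩ := artin_rees a (b ^ s) s
  set S := N + i + j + s with hS
  have hI' : a ^ S ≤ I := (Ideal.pow_le_pow_right (by omega)).trans hi
  have hJ' : b ^ S ≤ J := (Ideal.pow_le_pow_right (by omega)).trans hj
  have hc : a ^ S ⊓ b ^ S ≤ T := by
    refine le_trans ?_ hs
    refine (inf_le_inf (Ideal.pow_le_pow_right (by omega : N ≤ S)) (Ideal.pow_le_pow_right (by omega : s ≤ S))).trans (hN.trans ?_)
    rw [← mul_pow]
    exact Ideal.pow_right_mono Ideal.mul_le_inf s
  have e2 : pre (qm (inf_le_left : a ^ S ⊓ b ^ S ≤ a ^ S)) (pre (qm hI') u) = pre (qm (inf_le_right : a ^ S ⊓ b ^ S ≤ b ^ S)) (pre (qm hJ') v) := by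
    have := congrArg (pre (qm hc)) e
    rw [map_sub, map_sub, map_zero, sub_eq_zero] at this
    simp only [pre_pre, qm_comp] at this ⊢
    exact this
  obtain ⟨w, hw1, hw2⟩ := mv_glue _ _ e2
  have m0 : ∃ t : ℕ, (a ⊔ b) ^ t ≤ a ^ S ⊔ b ^ S := ⟨S + S, Ideal.sup_pow_add_le_pow_sup_pow⟩
  refine ⟨of _ n M _ m0 w, ?_, ?_⟩
  · refine (chg_of le_sup_left _ m0 ⟨S, le_sup_left⟩ w).trans ?_
    rw [← of_res ⟨S, le_rfl⟩ ⟨S, le_sup_left⟩ le_sup_left, hw1, of_res]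
  · refine (chg_of le_sup_right _ m0 ⟨S, le_sup_right⟩ w).trans ?_
    rw [← of_res ⟨S, le_rfl⟩ ⟨S, le_sup_right⟩ le_sup_right, hw2, of_res]
end
end LC

namespace LC
section
variable {R : Type u} [CommRing R]
variable {M N L : Type u} [AddCommGroup M] [Module R M] [AddCommGroup N] [Module R N] [AddCommGroup L] [Module R L] {n : ℕ}

def DD (R : Type u) [CommRing R] (M : Type u) [AddCommGroup M] [Module R M] (n : ℕ) : Prop :=
  ringKrullDim (R ⧸ Module.annihilator R M) ≤ (n : WithBot (WithTop ℕ))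

lemma dim_mono {I J : Ideal R} (h : I ≤ J) : ringKrullDim (R ⧸ J) ≤ ringKrullDim (R ⧸ I) :=
  ringKrullDim_le_of_surjective (Ideal.Quotient.factor h) (Ideal.Quotient.factor_surjective h)

lemma DD_mono (h : DD R M n) (h' : Module.annihilator R M ≤ Module.annihilator R N) : DD R N n :=
  (dim_mono h').trans h

lemma DD_quot (I : Ideal R) : DD R (R ⧸ I) n ↔ ringKrullDim (R ⧸ I) ≤ (n : WithBot (WithTop ℕ)) := by
  rw [DD, Ideal.annihilator_quotient]

lemma DD_inj (f : M →ₗ[R] N) (hf : Function.Injective f) (h : DD R N n) : DD R M n :=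
  DD_mono h (LinearMap.annihilator_le_of_injective f hf)
lemma DD_surj (f : M →ₗ[R] N) (hf : Function.Surjective f) (h : DD R M n) : DD R N n :=
  DD_mono h (LinearMap.annihilator_le_of_surjective f hf)

lemma dim_drop {p I : Ideal R} [p.IsPrime] {x : R} (hx : x ∉ p) (hp : p ≤ I) (hxI : x ∈ I)
    (h : ringKrullDim (R ⧸ p) ≤ ((n + 1 : ℕ) : WithBot (WithTop ℕ))) : ringKrullDim (R ⧸ I) ≤ (n : WithBot (WithTop ℕ)) := by
  have h1 : Ideal.Quotient.mk p x ∈ nonZeroDivisors (R ⧸ p) := by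
    rw [mem_nonZeroDivisors_iff_ne_zero]
    rwa [Ne, Ideal.Quotient.eq_zero_iff_mem]
  have := ringKrullDim_succ_le_of_surjective (Ideal.Quotient.factor hp) (Ideal.Quotient.factor_surjective hp) h1
    (by simpa [Ideal.Quotient.eq_zero_iff_mem] using hxI)
  have := this.trans h
  rw [Nat.cast_add, Nat.cast_one] at this
  exact ENat.WithBot.add_le_add_one_right_iff.1 this

lemma dim_zero [IsLocalRing R] {p : Ideal R} [hp : p.IsPrime] (h : ringKrullDim (R ⧸ p) ≤ ((0 : ℕ) : WithBot (WithTop ℕ))) :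
    p = IsLocalRing.maximalIdeal R := by
  have : Ring.KrullDimLE 0 (R ⧸ p) := by
    rw [Ring.krullDimLE_iff]; exact h
  have : p.IsMaximal := by
    apply Ideal.Quotient.maximal_of_isField
    exact Ring.KrullDimLE.isField_of_isDomain
  exact IsLocalRing.eq_maximalIdeal this

lemma pind [IsNoetherianRing R] (n : ℕ) (P : ∀ (N : Type u) [AddCommGroup N] [Module R N], Prop)
   (h0 : ∀ (N : Type u) [AddCommGroup N] [Module R N] [Subsingleton N], P N)
   (q : ∀ (p : Ideal R) [p.IsPrime], ringKrullDim (R ⧸ p) ≤ (n : WithBot (WithTop ℕ)) → P (R ⧸ p))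
   (ex : ∀ (N₁ N₂ N₃ : Type u) [AddCommGroup N₁] [Module R N₁] [Module.Finite R N₁] [AddCommGroup N₂] [Module R N₂] [Module.Finite R N₂]
      [AddCommGroup N₃] [Module R N₃] [Module.Finite R N₃] (f : N₁ →ₗ[R] N₂) (g : N₂ →ₗ[R] N₃), SES f g → DD R N₁ n → DD R N₂ n → DD R N₃ n →
      P N₁ → P N₃ → P N₂)
   (M : Type u) [AddCommGroup M] [Module R M] [hM : Module.Finite R M] (hd : DD R M n) : P M := by
  revert hd
  refine IsNoetherianRing.induction_on_isQuotientEquivQuotientPrime (A := R) hM (motive := fun N _ _ _ => DD R N n → P N) ?_ ?_ ?_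
  · intro N _ _ _ _ _; exact h0 N
  · intro N _ _ _ p e hN
    have h1 : DD R (R ⧸ p.1) n := DD_surj e.toLinearMap e.surjective hN
    have := p.2
    have hP := q p.1 ((DD_quot _).1 h1)
    refine ex (R ⧸ p.1) N PUnit.{u+1} e.symm.toLinearMap 0 ⟨e.symm.injective, Function.surjective_to_subsingleton _, ?_⟩ h1 hN ?_ hP (h0 _)
    · exact (e.symm.toLinearMap.exact_zero_iff_surjective _).2 e.symm.surjective
    · exact DD_surj (0 : N →ₗ[R] PUnit.{u+1}) (Function.surjective_to_subsingleton _) hN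
  · intro N₁ _ _ _ N₂ _ _ _ N₃ _ _ _ f g hf hg he h1 h3 h2
    exact ex N₁ N₂ N₃ f g ⟨hf, hg, he⟩ (DD_inj f hf h2) h2 (DD_surj g hg h2) (h1 (DD_inj f hf h2)) (h3 (DD_surj g hg h2))

lemma mulses (p : Ideal R) [p.IsPrime] {x : R} (hx : x ∉ p) :
    SES (x • LinearMap.id : (R ⧸ p) →ₗ[R] (R ⧸ p)) (qm (le_sup_left : p ≤ p ⊔ Ideal.span {x})) := by
  refine ⟨?_, ?_, ?_⟩
  · rw [injective_iff_map_eq_zero]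
    intro y hy
    obtain ⟨r, rfl⟩ := p.mkQ_surjective y
    have : p.mkQ (x * r) = 0 := hy
    have := (Submodule.Quotient.mk_eq_zero p).1 this
    exact (Submodule.Quotient.mk_eq_zero p).2 ((Ideal.IsPrime.mem_or_mem ‹_› this).resolve_left hx)
  · exact Submodule.factor_surjective _
  · intro y
    obtain ⟨r, rfl⟩ := p.mkQ_surjective y
    constructor
    · intro h
      have h := (Submodule.Quotient.mk_eq_zero (p ⊔ Ideal.span {x})).1 h
      obtain ⟨i, hi, j, hj, e⟩ := Submodule.mem_sup.1 h
      obtain ⟨c, rfl⟩ := Ideal.mem_span_singleton'.1 hj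
      refine ⟨p.mkQ c, ?_⟩
      refine (Submodule.Quotient.eq p).2 ?_
      have : x * c - r = - i := by linear_combination e
      exact this.symm ▸ neg_mem hi
    · rintro ⟨z, hz⟩
      obtain ⟨c, rfl⟩ := p.mkQ_surjective z
      have h := (Submodule.Quotient.eq p).1 hz
      refine (Submodule.Quotient.mk_eq_zero (p ⊔ Ideal.span {x})).2 ?_
      have h : x * c - r ∈ p := h
      have e : r = - (x * c - r) + c * x := by ring
      exact e.symm ▸ add_mem (neg_mem (Ideal.mem_sup_left h)) (Ideal.mem_sup_right (Ideal.mem_span_singleton'.2 ⟨c, rfl⟩))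

lemma bump {p b : Ideal R} [hp : p.IsPrime] {x : R} (hx : x ∉ p) (hxb : x ∈ b) (u : H b (n+1) (R ⧸ p)) :
    ∃ (y : R) (hy : y ∉ p) (v : H b n (R ⧸ (p ⊔ Ideal.span {y}))), y ∈ b ∧ dl b (mulses p hy) v = u := by
  obtain ⟨t, ht⟩ := tors u
  have hy : x ^ (t+1) ∉ p := fun h => hx (hp.mem_of_pow_mem _ h)
  have h1 : map b (n+1) (x ^ (t+1) • LinearMap.id : (R ⧸ p) →ₗ[R] (R ⧸ p)) u = 0 := by
    rw [map_smul']
    exact ht _ (Ideal.pow_le_pow_right (Nat.le_succ t) (Ideal.pow_mem_pow hxb _))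
  obtain ⟨v, hv⟩ := hex1 (mulses p hy) u h1
  exact ⟨_, hy, v, Ideal.pow_mem_of_mem _ hxb _ (Nat.succ_pos _), hv⟩

lemma tor_quot {a p : Ideal R} (h : a ≤ p) : Tor a (R ⧸ p) := by
  intro m
  refine ⟨1, fun r hr => ?_⟩
  obtain ⟨y, rfl⟩ := p.mkQ_surjective m
  rw [pow_one] at hr
  exact (Submodule.Quotient.mk_eq_zero p).2 (p.mul_mem_right _ (h hr))

lemma H_sub [Subsingleton M] {J : Ideal R} (x : H J n M) : x = 0 := by
  have := smul_zero_of (1 : R) (fun m : M => Subsingleton.elim _ _) x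
  rwa [one_smul] at this

def HZ (a : Ideal R) (i : ℕ) (N : Type u) [AddCommGroup N] [Module R N] : Prop := ∀ x : H a i N, x = 0

theorem vanish [IsNoetherianRing R] [IsLocalRing R] (a : Ideal R) (n : ℕ) : ∀ (i : ℕ), n < i → ∀ (M : Type u) [AddCommGroup M] [Module R M] [Module.Finite R M], DD R M n → 
    HZ a i M := by
  induction n with
  | zero =>
    intro i hi M _ _ _ hd
    have key := pind (R := R) 0 (fun N _ _ => HZ a i N)
    refine key ?_ ?_ ?_ M hd
    · intro N _ _ _ x; exact H_sub x
    · intro p _ hp x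
      have := dim_zero hp
      obtain ⟨j, rfl⟩ : ∃ j, i = j + 1 := ⟨i - 1, by omega⟩
      by_cases ha : a = ⊤
      · subst ha; exact H_top x
      · exact H_tor_zero (tor_quot (this ▸ IsLocalRing.le_maximalIdeal ha)) x
    · intro N₁ N₂ N₃ _ _ _ _ _ _ _ _ _ f g hs _ _ _ h1 h3 x
      obtain ⟨y, rfl⟩ := hex2 hs x (h3 _)
      rw [h1 y, _root_.map_zero]
  | succ n ih =>
    intro i hi M _ _ _ hd
    have key := pind (R := R) (n+1) (fun N _ _ => HZ a i N)
    refine key ?_ ?_ ?_ M hd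
    · intro N _ _ _ x; exact H_sub x
    · intro p _ hp x
      obtain ⟨j, rfl⟩ : ∃ j, i = j + 1 := ⟨i - 1, by omega⟩
      by_cases ha : a ≤ p
      · exact H_tor_zero (tor_quot ha) x
      · obtain ⟨r, hr, hrp⟩ := Set.not_subset.1 ha
        obtain ⟨y, hy, v, _, rfl⟩ := bump hrp hr x
        rw [ih j (by omega) _ ((DD_quot _).2 (dim_drop hy le_sup_left (Ideal.mem_sup_right (Ideal.mem_span_singleton_self y)) hp)) v, _root_.map_zero]
    · intro N₁ N₂ N₃ _ _ _ _ _ _ _ _ _ f g hs _ _ _ h1 h3 x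
      obtain ⟨y, rfl⟩ := hex2 hs x (h3 _)
      rw [h1 y, _root_.map_zero]

lemma map_surj [IsNoetherianRing R] [IsLocalRing R] (a : Ideal R) {f : M →ₗ[R] N} {g : N →ₗ[R] L} (h : SES f g) [Module.Finite R M] (hd : DD R M n) :
    Function.Surjective (map a n g) := fun x => hex3 h x (vanish a n _ (Nat.lt_succ_self n) M hd _)

lemma ses_ker {g : N →ₗ[R] L} (hg : Function.Surjective g) : SES (LinearMap.ker g).subtype g :=
  ⟨Subtype.val_injective, hg, by intro y; simp⟩

lemma map_surj' [IsNoetherianRing R] [IsLocalRing R] (a : Ideal R) {g : N →ₗ[R] L} (hg : Function.Surjective g) [Module.Finite R N] (hd : DD R N n) :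
    Function.Surjective (map a n g) := map_surj a (ses_ker hg) (DD_inj (LinearMap.ker g).subtype Subtype.val_injective hd)

theorem mtors [IsNoetherianRing R] [IsLocalRing R] (b : Ideal R) (n : ℕ) : ∀ (M : Type u) [AddCommGroup M] [Module R M] [Module.Finite R M], DD R M n → 
    Tor (IsLocalRing.maximalIdeal R) (H b n M) := by
  have ex : ∀ n (N₁ N₂ N₃ : Type u) [AddCommGroup N₁] [Module R N₁] [Module.Finite R N₁] [AddCommGroup N₂] [Module R N₂] [Module.Finite R N₂]
      [AddCommGroup N₃] [Module R N₃] [Module.Finite R N₃] (f : N₁ →ₗ[R] N₂) (g : N₂ →ₗ[R] N₃), SES f g → DD R N₁ n → DD R N₂ n → DD R N₃ n →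
      Tor (IsLocalRing.maximalIdeal R) (H b n N₁) → Tor (IsLocalRing.maximalIdeal R) (H b n N₃) → Tor (IsLocalRing.maximalIdeal R) (H b n N₂) := by
    intro n N₁ N₂ N₃ _ _ _ _ _ _ _ _ _ f g hs _ _ _ h1 h3 x
    obtain ⟨t, ht⟩ := h3 (map b n g x)
    have : ∀ r ∈ IsLocalRing.maximalIdeal R ^ t, ∃ s : ℕ, ∀ r' ∈ IsLocalRing.maximalIdeal R ^ s, r' • r • x = 0 := by
      intro r hr
      obtain ⟨y, hy⟩ := hex2 hs (r • x) (by rw [map_smul, ht r hr])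
      obtain ⟨s, hs⟩ := h1 y
      exact ⟨s, fun r' hr' => by rw [← hy, ← map_smul, hs r' hr', _root_.map_zero]⟩
    -- uniform via finite generation
    obtain ⟨s, hs⟩ : ∃ s : ℕ, ∀ r ∈ IsLocalRing.maximalIdeal R ^ t, ∀ r' ∈ IsLocalRing.maximalIdeal R ^ s, r' • r • x = 0 := by
      have hT : Tor (IsLocalRing.maximalIdeal R) (LinearMap.range ((LinearMap.toSpanSingleton R _ x) ∘ₗ (IsLocalRing.maximalIdeal R ^ t).subtype)) := by
        rintro ⟨_, ⟨⟨r, hr⟩, rfl⟩⟩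
        obtain ⟨s, hs⟩ := this r hr
        exact ⟨s, fun r' hr' => Subtype.ext (hs r' hr')⟩
      obtain ⟨s, hs⟩ := fg_kill hT (LinearMap.rangeRestrict ((LinearMap.toSpanSingleton R _ x) ∘ₗ (IsLocalRing.maximalIdeal R ^ t).subtype))
      exact ⟨s, fun r hr r' hr' => congrArg Subtype.val (hs r' hr' ⟨r, hr⟩)⟩
    refine ⟨s + t, fun r hr => ?_⟩
    rw [pow_add] at hr
    refine Submodule.mul_induction_on hr ?_ ?_
    · intro r hr r' hr'
      rw [mul_smul]; exact hs r' hr' r hr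
    · intro r r' h h'; rw [add_smul, h, h', add_zero]
  induction n with
  | zero =>
    intro M _ _ _ hd
    refine pind 0 (fun N _ _ => Tor _ (H b 0 N)) ?_ ?_ (ex 0) M hd
    · intro N _ _ _ x; exact ⟨0, fun r _ => by rw [H_sub x, smul_zero]⟩
    · intro p _ hp x
      have e := dim_zero hp
      refine ⟨1, fun r hr => smul_zero_of r ?_ x⟩
      intro m
      obtain ⟨y, rfl⟩ := p.mkQ_surjective m
      rw [pow_one, ← e] at hr
      exact (Submodule.Quotient.mk_eq_zero p).2 (p.mul_mem_right _ hr)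
  | succ n ih =>
    intro M _ _ _ hd
    refine pind (n+1) (fun N _ _ => Tor _ (H b (n+1) N)) ?_ ?_ (ex (n+1)) M hd
    · intro N _ _ _ x; exact ⟨0, fun r _ => by rw [H_sub x, smul_zero]⟩
    · intro p _ hp x
      by_cases ha : b ≤ p
      · exact ⟨0, fun r _ => by rw [H_tor_zero (tor_quot ha) x, smul_zero]⟩
      · obtain ⟨r, hr, hrp⟩ := Set.not_subset.1 ha
        obtain ⟨y, hy, v, _, rfl⟩ := bump hrp hr x
        obtain ⟨t, ht⟩ := ih _ ((DD_quot _).2 (dim_drop hy le_sup_left (Ideal.mem_sup_right (Ideal.mem_span_singleton_self y)) hp)) v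
        exact ⟨t, fun r hr => by rw [← map_smul, ht r hr, _root_.map_zero]⟩
end
end LC

namespace LC
section
variable {R : Type u} [CommRing R]
variable {M N L : Type u} [AddCommGroup M] [Module R M] [AddCommGroup N] [Module R N] [AddCommGroup L] [Module R L] {n : ℕ}

lemma bump' {p b c : Ideal R} [hp : p.IsPrime] (hT : Tor c (H b (n+1) (R ⧸ p))) {x : R} (hx : x ∉ p) (hxb : x ∈ c) (u : H b (n+1) (R ⧸ p)) :
    ∃ (y : R) (hy : y ∉ p) (v : H b n (R ⧸ (p ⊔ Ideal.span {y}))), dl b (mulses p hy) v = u := by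
  obtain ⟨t, ht⟩ := hT u
  have hy : x ^ t ∉ p := fun h => hx (hp.mem_of_pow_mem _ h)
  have h1 : map b (n+1) (x ^ t • LinearMap.id : (R ⧸ p) →ₗ[R] (R ⧸ p)) u = 0 := by
    rw [map_smul']
    exact ht _ (Ideal.pow_mem_pow hxb _)
  obtain ⟨v, hv⟩ := hex1 (mulses p hy) u h1
  exact ⟨_, hy, v, hv⟩

lemma chg_surj_tor [IsNoetherianRing R] {a b : Ideal R} (h : b ≤ a) (hM : Tor a M) : Function.Surjective (chg n M h) := by
  intro y
  obtain ⟨I, ⟨t, hI⟩, u, rfl⟩ := exists_of y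
  obtain ⟨s, hs⟩ := T1 hM u
  have hK : LinearMap.ker (qm (le_sup_left : I ≤ I ⊔ a ^ s)) ≤ (a ^ s • ⊤ : Submodule R (R ⧸ I)) := by
    intro x hx
    obtain ⟨r, rfl⟩ := I.mkQ_surjective x
    have hx := (Submodule.Quotient.mk_eq_zero (I ⊔ a ^ s)).1 (LinearMap.mem_ker.1 hx)
    obtain ⟨i, hi, j, hj, rfl⟩ := Submodule.mem_sup.1 hx
    have : I.mkQ (i + j) = j • I.mkQ 1 := by
      refine (Submodule.Quotient.eq I).2 ?_
      have : i + j - j • 1 = i := by simp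
      exact this.symm ▸ hi
    rw [this]
    exact Submodule.smul_mem_smul hj Submodule.mem_top
  have h0 : pre (LinearMap.ker (qm (le_sup_left : I ≤ I ⊔ a ^ s))).subtype u = 0 := by
    have := congrArg (pre (Submodule.inclusion hK)) hs
    rw [pre_pre, map_zero] at this
    exact this
  obtain ⟨w, hw⟩ := cex2 (ses_ker (g := qm (le_sup_left : I ≤ I ⊔ a ^ s)) (Submodule.factor_surjective _)) u h0
  refine ⟨of a n M (I ⊔ a ^ s) ⟨s, le_sup_right⟩ w, ?_⟩
  refine (chg_of h _ _ ⟨t, hI.trans le_sup_left⟩ w).trans ?_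
  rw [← hw, of_res]

def Sj {a b : Ideal R} (h : b ≤ a) (n : ℕ) (N : Type u) [AddCommGroup N] [Module R N] : Prop := Function.Surjective (chg n N h)

lemma Sj_ex [IsNoetherianRing R] [IsLocalRing R] {a b : Ideal R} (h : b ≤ a) (n : ℕ)
   (N₁ N₂ N₃ : Type u) [AddCommGroup N₁] [Module R N₁] [Module.Finite R N₁] [AddCommGroup N₂] [Module R N₂] [Module.Finite R N₂]
      [AddCommGroup N₃] [Module R N₃] [Module.Finite R N₃] (f : N₁ →ₗ[R] N₂) (g : N₂ →ₗ[R] N₃) (hs : SES f g) (d1 : DD R N₁ n) (_ : DD R N₂ n) (_ : DD R N₃ n)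
      (h1 : Sj h n N₁) (h3 : Sj h n N₃) : Sj h n N₂ := by
  intro y
  obtain ⟨z3, hz3⟩ := h3 (map b n g y)
  obtain ⟨z2, rfl⟩ := map_surj a hs d1 z3
  rw [chg_map] at hz3
  obtain ⟨y1, hy1⟩ := hex2 hs (y - chg n N₂ h z2) (by rw [map_sub, hz3, sub_self])
  obtain ⟨z1, rfl⟩ := h1 y1
  refine ⟨map a n f z1 + z2, ?_⟩
  rw [map_add, chg_map, hy1, sub_add_cancel]

theorem chg_surj [IsNoetherianRing R] [IsLocalRing R] {a b : Ideal R} (h : b ≤ a) (ha : a ≤ IsLocalRing.maximalIdeal R) (n : ℕ) :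
   ∀ (M : Type u) [AddCommGroup M] [Module R M] [Module.Finite R M], DD R M n → Sj h n M := by
  induction n with
  | zero =>
    intro M _ _ _ hd
    have key := pind (R := R) 0 (fun N _ _ => Sj h 0 N)
    refine key ?_ ?_ (Sj_ex h 0) M hd
    · intro N _ _ _ x; exact ⟨0, by rw [H_sub x, map_zero]⟩
    · intro p _ hp
      exact chg_surj_tor h (tor_quot (dim_zero hp ▸ ha))
  | succ n ih =>
    intro M _ _ _ hd
    have key := pind (R := R) (n+1) (fun N _ _ => Sj h (n+1) N)
    refine key ?_ ?_ (Sj_ex h (n+1)) M hd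
    · intro N _ _ _ x; exact ⟨0, by rw [H_sub x, map_zero]⟩
    · intro p _ hp
      by_cases hap : a ≤ p
      · exact chg_surj_tor h (tor_quot hap)
      · intro x
        obtain ⟨r, hr, hrp⟩ := Set.not_subset.1 hap
        obtain ⟨y, hy, v, rfl⟩ := bump' (mtors b (n+1) _ ((DD_quot _).2 hp)) hrp (ha hr) x
        obtain ⟨w, rfl⟩ := ih _ ((DD_quot _).2 (dim_drop hy le_sup_left (Ideal.mem_sup_right (Ideal.mem_span_singleton_self y)) hp)) v
        exact ⟨dl a (mulses p hy) w, chg_dl h _ w⟩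
end
end LC

namespace LC
section
open TensorProduct
variable {R : Type u} [CommRing R]
variable {M N L : Type u} [AddCommGroup M] [Module R M] [AddCommGroup N] [Module R N] [AddCommGroup L] [Module R L] {n : ℕ}

lemma exists_nonzero_hom [Module.Finite R M] (p : Ideal R) [hp : p.IsPrime] (h : Module.annihilator R M ≤ p) :
    ∃ f : M →ₗ[R] (R ⧸ p), f ≠ 0 := by
  have hs : (⟨p, hp⟩ : PrimeSpectrum R) ∈ Module.support R M := by
    rw [Module.support_eq_zeroLocus]; exact h
  rw [Module.mem_support_iff_nontrivial_residueField_tensorProduct] at hs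
  let κ := p.ResidueField
  have hs : Nontrivial (κ ⊗[R] M) := hs
  obtain ⟨v, hv⟩ := exists_ne (0 : κ ⊗[R] M)
  obtain ⟨φ, hφ⟩ := Module.Projective.exists_dual_ne_zero κ hv
  let g : M →ₗ[R] κ := (φ.restrictScalars R) ∘ₗ (TensorProduct.mk R κ M 1)
  have hg : ∃ m, g m ≠ 0 := by
    by_contra! hc
    apply hφ
    induction v using TensorProduct.induction_on with
    | zero => simp
    | tmul c m =>
      have : c ⊗ₜ[R] m = c • ((1 : κ) ⊗ₜ[R] m) := by rw [TensorProduct.smul_tmul', smul_eq_mul, mul_one]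
      rw [this, map_smul]
      have h2 : φ ((1 : κ) ⊗ₜ[R] m) = 0 := hc m
      rw [h2, smul_zero]
    | add x y hx hy =>
      have : ∀ z : κ ⊗[R] M, φ z = 0 := by
        intro z
        induction z using TensorProduct.induction_on with
        | zero => simp
        | tmul c m =>
          have : c ⊗ₜ[R] m = c • ((1 : κ) ⊗ₜ[R] m) := by rw [TensorProduct.smul_tmul', smul_eq_mul, mul_one]
          rw [this, map_smul]
          have h2 : φ ((1 : κ) ⊗ₜ[R] m) = 0 := hc m
          rw [h2, smul_zero]
        | add x y hx hy => rw [map_add, hx, hy, add_zero]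
      exact this _
  obtain ⟨m0, hm0⟩ := hg
  obtain ⟨S, hS⟩ := Module.Finite.fg_top (R := R) (M := M)
  obtain ⟨b, hb⟩ := IsLocalization.exist_integer_multiples (nonZeroDivisors (R ⧸ p)) (S := κ) S g
  obtain ⟨r, hr⟩ := Ideal.Quotient.mk_surjective b.1
  have hrs : ∀ k : κ, b.1 • k = r • k := by
    intro k
    rw [← hr]
    exact algebraMap_smul (R ⧸ p) r k
  let ι : (R ⧸ p) →ₗ[R] κ := (Algebra.linearMap (R ⧸ p) κ).restrictScalars R
  have hι : Function.Injective ι := IsFractionRing.injective (R ⧸ p) κ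
  have hmem : ∀ m, r • g m ∈ LinearMap.range ι := by
    intro m
    have hx : m ∈ Submodule.span R (S : Set M) := hS ▸ Submodule.mem_top
    induction hx using Submodule.span_induction with
    | mem y hy =>
      obtain ⟨z, hz⟩ := hb y hy
      exact ⟨z, hz.trans (hrs _)⟩
    | zero => rw [map_zero, smul_zero]; exact zero_mem _
    | add y z _ _ h1 h2 => rw [map_add, smul_add]; exact add_mem h1 h2
    | smul c y _ h => rw [map_smul, smul_comm]; exact Submodule.smul_mem _ _ h
  let F : M →ₗ[R] LinearMap.range ι := LinearMap.codRestrict (LinearMap.range ι) (r • g) hmem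
  refine ⟨(LinearEquiv.ofInjective ι hι).symm.toLinearMap ∘ₗ F, fun h => ?_⟩
  have h1 := LinearMap.congr_fun h m0
  have h2 : F m0 = 0 := (LinearEquiv.ofInjective ι hι).symm.map_eq_zero_iff.1 h1
  have h3 : r • g m0 = 0 := congrArg Subtype.val h2
  rw [← hrs, Algebra.smul_def, mul_eq_zero] at h3
  refine h3.elim (fun h => ?_) hm0
  have : b.1 = 0 := IsFractionRing.injective (R ⧸ p) κ (h.trans (map_zero _).symm)
  exact nonZeroDivisors.ne_zero b.2 this

lemma prod_dec {J : Ideal R} (x : H J n (M × N)) : ∃ a b, x = map J n (LinearMap.inl R M N) a + map J n (LinearMap.inr R M N) b := by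
  have hs : SES (LinearMap.inr R M N) (LinearMap.fst R M N) := ⟨LinearMap.inr_injective, LinearMap.fst_surjective, by
    intro y; constructor
    · intro h; exact ⟨y.2, Prod.ext (Eq.symm h) rfl⟩
    · rintro ⟨z, rfl⟩; rfl⟩
  obtain ⟨b, hb⟩ := hex2 hs (x - map J n (LinearMap.inl R M N) (map J n (LinearMap.fst R M N) x)) (by
    rw [map_sub, map_map' (LinearMap.inl R M N), LinearMap.fst_comp_inl, map_id', sub_self])
  exact ⟨_, b, by rw [hb]; abel⟩

lemma span_top' (r : R) (m : M) (hm : m ∈ ((Ideal.span {r} : Ideal R) • ⊤ : Submodule R M)) : ∃ y, r • y = m := by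
  refine Submodule.smul_induction_on hm ?_ ?_
  · intro s hs y _
    obtain ⟨c, rfl⟩ := Ideal.mem_span_singleton'.1 hs
    exact ⟨c • y, by rw [smul_smul, mul_comm]⟩
  · rintro _ _ ⟨y, rfl⟩ ⟨z, rfl⟩
    exact ⟨y + z, smul_add _ _ _⟩

lemma map_sup [IsNoetherianRing R] [IsLocalRing R] (a : Ideal R) [Module.Finite R M] (hd : DD R M n) {A B C : Submodule R M} (hC : C = A ⊔ B)
    (T : Submodule R (H a n M)) (hA : ∀ x, map a n A.subtype x ∈ T) (hB : ∀ x, map a n B.subtype x ∈ T) (x : H a n C) : map a n C.subtype x ∈ T := by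
  have l1 : A ≤ C := hC ▸ le_sup_left
  have l2 : B ≤ C := hC ▸ le_sup_right
  have hf : Function.Surjective ((Submodule.inclusion l1).coprod (Submodule.inclusion l2)) := by
    rintro ⟨m, hm⟩
    have hm' := hm
    rw [hC] at hm'
    obtain ⟨i, hi, j, hj, rfl⟩ := Submodule.mem_sup.1 hm'
    exact ⟨(⟨i, hi⟩, ⟨j, hj⟩), Subtype.ext rfl⟩
  have hd' : DD R (A × B) n := by
    refine DD_mono hd ?_
    intro r hr
    rw [Module.mem_annihilator] at hr ⊢
    rintro ⟨⟨i, hi⟩, ⟨j, hj⟩⟩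
    exact Prod.ext (Subtype.ext (hr i)) (Subtype.ext (hr j))
  obtain ⟨y, rfl⟩ := map_surj' a hf hd' x
  obtain ⟨y1, y2, rfl⟩ := prod_dec y
  rw [map_add, map_add]
  refine add_mem ?_ ?_
  · rw [map_map', map_map', LinearMap.comp_assoc, LinearMap.coprod_inl]
    exact hA y1
  · rw [map_map', map_map', LinearMap.comp_assoc, LinearMap.coprod_inr]
    exact hB y2

lemma map_mem_smul [IsNoetherianRing R] [IsLocalRing R] (a : Ideal R) [Module.Finite R M] (hd : DD R M n) (I : Ideal R) :
    ∀ x : H a n (I • ⊤ : Submodule R M), map a n (I • ⊤ : Submodule R M).subtype x ∈ (I • ⊤ : Submodule R (H a n M)) := by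
  refine Submodule.fg_induction (motive := fun I _ => ∀ x : H a n ((I : Ideal R) • ⊤ : Submodule R M), map a n ((I : Ideal R) • ⊤ : Submodule R M).subtype x ∈ ((I : Ideal R) • ⊤ : Submodule R (H a n M))) ?_ ?_ I (IsNoetherian.noetherian I)
  · intro r x
    let f : M →ₗ[R] ((Ideal.span {r} : Ideal R) • ⊤ : Submodule R M) := LinearMap.codRestrict _ (r • LinearMap.id)
      (fun m => Submodule.smul_mem_smul (Ideal.mem_span_singleton_self r) Submodule.mem_top)
    have hf : Function.Surjective f := by
      rintro ⟨m, hm⟩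
      obtain ⟨y, hy⟩ := span_top' r m hm
      exact ⟨y, Subtype.ext hy⟩
    obtain ⟨y, rfl⟩ := map_surj' a hf hd x
    have e : ((Ideal.span {r} : Ideal R) • ⊤ : Submodule R M).subtype ∘ₗ f = r • LinearMap.id := rfl
    have : map a n ((Ideal.span {r} : Ideal R) • ⊤ : Submodule R M).subtype (map a n f y) = r • y := by
      rw [map_map', e, map_smul']
    exact this.symm ▸ Submodule.smul_mem_smul (Ideal.mem_span_singleton_self r) Submodule.mem_top
  · intro I1 I2 _ _ h1 h2 x
    exact map_sup a hd (Submodule.sup_smul I1 I2 ⊤) _ (fun y => Submodule.smul_mono_left le_sup_left (h1 y)) (fun y => Submodule.smul_mono_left le_sup_right (h2 y)) x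

def PZ (p a : Ideal R) (i : ℕ) (N : Type u) [AddCommGroup N] [Module R N] : Prop := p ≤ Module.annihilator R N → HZ a i N

lemma HZ_of_prime [IsNoetherianRing R] [IsLocalRing R] (a p : Ideal R) [p.IsPrime] (hz : HZ a (n+1) (R ⧸ p))
    (hdp : ringKrullDim (R ⧸ p) ≤ ((n+1 : ℕ) : WithBot (WithTop ℕ))) 
    (M : Type u) [AddCommGroup M] [Module R M] [Module.Finite R M] (hd : DD R M (n+1)) : PZ p a (n+1) M := by
  have key := pind (R := R) (n+1) (fun N _ _ => PZ p a (n+1) N)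
  refine key ?_ ?_ ?_ M hd
  · intro N _ _ _ _ x; exact H_sub x
  · intro q _ hq hpq
    rw [Ideal.annihilator_quotient] at hpq
    by_cases e : p = q
    · subst e; exact hz
    · obtain ⟨x, hx, hxp⟩ := SetLike.exists_of_lt (lt_of_le_of_ne hpq e)
      exact vanish a n (n+1) (Nat.lt_succ_self n) _ ((DD_quot _).2 (dim_drop hxp hpq hx hdp))
  · intro N₁ N₂ N₃ _ _ _ _ _ _ _ _ _ f g hs _ _ _ h1 h3 hp x
    obtain ⟨y, rfl⟩ := hex2 hs x (h3 (hp.trans (LinearMap.annihilator_le_of_surjective g hs.surj)) _)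
    rw [h1 (hp.trans (LinearMap.annihilator_le_of_injective f hs.inj)) y, map_zero]

def IsAtt (p : Ideal R) (N : Type u) [AddCommGroup N] [Module R N] : Prop :=
  p.IsPrime ∧ ∃ K : Submodule R N, p = Module.annihilator R (N ⧸ K)

lemma quot_div [IsNoetherianRing R] [IsLocalRing R] (a p : Ideal R) [p.IsPrime] 
    (hdp : ringKrullDim (R ⧸ p) ≤ ((n+1 : ℕ) : WithBot (WithTop ℕ))) {x : R} (hx : x ∉ p) (u : H a (n+1) (R ⧸ p)) : ∃ v, x • v = u := by
  obtain ⟨v, hv⟩ := hex2 (mulses p hx) u (vanish a n (n+1) (Nat.lt_succ_self n) _ ((DD_quot _).2 (dim_drop hx le_sup_left (Ideal.mem_sup_right (Ideal.mem_span_singleton_self x)) hdp)) _)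
  rw [map_smul'] at hv
  exact ⟨v, hv⟩

theorem attF [IsNoetherianRing R] [IsLocalRing R] (a p : Ideal R) [Module.Finite R M] (hd : DD R M (n+1)) :
    IsAtt p (H a (n+1) M) ↔ p.IsPrime ∧ Module.annihilator R M ≤ p ∧ ¬ HZ a (n+1) (R ⧸ p) := by
  constructor
  · rintro ⟨hp, K, hK⟩
    have hMp : Module.annihilator R M ≤ p := by
      intro r hr
      rw [hK, Module.mem_annihilator]
      intro m
      obtain ⟨y, rfl⟩ := K.mkQ_surjective m
      rw [← map_smul, smul_zero_of r (Module.mem_annihilator.1 hr) y, map_zero]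
    refine ⟨hp, hMp, fun hz => ?_⟩
    have hdp := (dim_mono hMp).trans hd
    have hq : p ≤ Module.annihilator R (M ⧸ (p • ⊤ : Submodule R M)) := by
      intro r hr
      rw [Module.mem_annihilator]
      intro m
      obtain ⟨y, rfl⟩ := (p • ⊤ : Submodule R M).mkQ_surjective m
      exact (Submodule.Quotient.mk_eq_zero _).2 (Submodule.smul_mem_smul hr Submodule.mem_top)
    have hz' := HZ_of_prime a p hz hdp (M ⧸ (p • ⊤ : Submodule R M)) (DD_surj _ (Submodule.mkQ_surjective _) hd) hq
    have htop : K = ⊤ := by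
      rw [eq_top_iff]
      intro x _
      obtain ⟨y, rfl⟩ := hex2 (ses_sub (p • ⊤ : Submodule R M)) x (hz' _)
      have h1 := map_mem_smul a hd p y
      refine (Submodule.smul_le.2 ?_ : (p • ⊤ : Submodule R (H a (n+1) M)) ≤ K) h1
      intro r hr m _
      rw [hK, Module.mem_annihilator] at hr
      exact (Submodule.Quotient.mk_eq_zero K).1 (hr (K.mkQ m))
    apply hp.ne_top
    rw [hK, Module.annihilator_eq_top_iff, Submodule.Quotient.subsingleton_iff, htop]
  · rintro ⟨hp, hMp, hnz⟩
    have hdp := (dim_mono hMp).trans hd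
    refine ⟨hp, ?_⟩
    obtain ⟨f, hf⟩ := exists_nonzero_hom p hMp
    have hI : (LinearMap.range f) ≠ ⊥ := by rwa [Ne, LinearMap.range_eq_bot]
    obtain ⟨y, hy, hy0⟩ := Submodule.exists_mem_ne_zero_of_ne_bot hI
    obtain ⟨x, rfl⟩ := p.mkQ_surjective y
    have hx : x ∉ p := fun h => hy0 ((Submodule.Quotient.mk_eq_zero p).2 h)
    have hann : ∀ r ∈ p ⊔ Ideal.span {x}, r ∈ Module.annihilator R ((R ⧸ p) ⧸ LinearMap.range f) := by
      have : p ⊔ Ideal.span {x} ≤ Module.annihilator R ((R ⧸ p) ⧸ LinearMap.range f) := by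
        rw [sup_le_iff]
        refine ⟨?_, ?_⟩
        · exact (Ideal.annihilator_quotient (I := p)).ge.trans (LinearMap.annihilator_le_of_surjective (LinearMap.range f).mkQ (Submodule.mkQ_surjective _))
        · rw [Ideal.span_singleton_le_iff_mem, Module.mem_annihilator]
          intro m
          obtain ⟨z, rfl⟩ := Submodule.mkQ_surjective _ m
          obtain ⟨t, rfl⟩ := p.mkQ_surjective z
          refine (Submodule.Quotient.mk_eq_zero (LinearMap.range f)).2 ?_
          have e : x • p.mkQ t = t • p.mkQ x := by
            rw [← map_smul, ← map_smul, smul_eq_mul, smul_eq_mul, mul_comm]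
          exact (congrArg (· ∈ LinearMap.range f) e).mpr (Submodule.smul_mem _ t hy)
      exact this
    have hQ : DD R ((R ⧸ p) ⧸ LinearMap.range f) n := 
      (dim_mono hann).trans (dim_drop hx le_sup_left (Ideal.mem_sup_right (Ideal.mem_span_singleton_self x)) hdp)
    have hs : Function.Surjective (map a (n+1) f) := by
      intro z
      obtain ⟨w, rfl⟩ := hex2 (ses_sub (LinearMap.range f)) z (vanish a n (n+1) (Nat.lt_succ_self n) _ hQ _)
      obtain ⟨v, rfl⟩ := map_surj' a f.surjective_rangeRestrict hd w
      exact ⟨v, by rw [map_map']; rfl⟩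
    refine ⟨LinearMap.ker (map a (n+1) f), ?_⟩
    rw [((map a (n+1) f).quotKerEquivOfSurjective hs).annihilator_eq]
    refine le_antisymm ?_ ?_
    · intro r hr
      rw [Module.mem_annihilator]
      refine smul_zero_of r ?_
      exact Module.mem_annihilator.1 ((Ideal.annihilator_quotient (I := p)).ge hr)
    · intro r hr
      by_contra hrp
      apply hnz
      intro u
      obtain ⟨v, rfl⟩ := quot_div a p hdp hrp u
      exact Module.mem_annihilator.1 hr v
end
end LC

namespace LC
section
variable {R : Type u} [CommRing R] [IsLocalRing R]


structure Hull (R : Type u) [CommRing R] [IsLocalRing R] (E : Type u) [AddCommGroup E] [Module R E] : Prop where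
  inj : Module.Injective R E
  soc : ∃ e0 : E, e0 ≠ 0 ∧ (∀ r ∈ IsLocalRing.maximalIdeal R, r • e0 = 0) ∧ ∀ e : E, (∀ r ∈ IsLocalRing.maximalIdeal R, r • e = 0) → ∃ c : R, e = c • e0

def Ess {E : Type u} [AddCommGroup E] [Module R E] (S W : Submodule R E) : Prop := ∀ x ∈ W, x ≠ 0 → ∃ r : R, r • x ∈ S ∧ r • x ≠ 0

lemma exists_max_ess {E : Type u} [AddCommGroup E] [Module R E] (S : Submodule R E) :
    ∃ W : Submodule R E, S ≤ W ∧ Ess S W ∧ ∀ W', W ≤ W' → Ess S W' → W' = W := by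
  obtain ⟨W, hSW, hW⟩ := zorn_le_nonempty₀ {W : Submodule R E | Ess S W} (fun c hc hch y hy => by
    refine ⟨sSup c, ?_, fun z hz => le_sSup hz⟩
    intro x hx hx0
    obtain ⟨W, hW, hxW⟩ := (Submodule.mem_sSup_of_directed ⟨y, hy⟩ hch.directedOn).1 hx
    exact hc hW x hxW hx0) S (fun x hx hx0 => ⟨1, by simpa using hx, by simpa using hx0⟩)
  exact ⟨W, hSW, hW.prop, fun W' h h' => le_antisymm (hW.2 h' h) h⟩

lemma exists_max_disj {E : Type u} [AddCommGroup E] [Module R E] (S : Submodule R E) :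
    ∃ Z : Submodule R E, Disjoint Z S ∧ ∀ Z', Z ≤ Z' → Disjoint Z' S → Z' = Z := by
  obtain ⟨W, -, hW⟩ := zorn_le_nonempty₀ {W : Submodule R E | Disjoint W S} (fun c hc hch y hy => by
    refine ⟨sSup c, ?_, fun z hz => le_sSup hz⟩
    rw [Set.mem_setOf_eq, Submodule.disjoint_def]
    intro x hx hx0
    obtain ⟨W, hW, hxW⟩ := (Submodule.mem_sSup_of_directed ⟨y, hy⟩ hch.directedOn).1 hx
    exact Submodule.disjoint_def.1 (hc hW) x hxW hx0) ⊥ (disjoint_bot_left)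
  exact ⟨W, hW.prop, fun W' h h' => le_antisymm (hW.2 h' h) h⟩

lemma exists_retract {E0 : Type u} [AddCommGroup E0] [Module R E0] (hE : Module.Injective R E0) (S : Submodule R E0) :
    ∃ W : Submodule R E0, S ≤ W ∧ Ess S W ∧ ∃ ρ : E0 →ₗ[R] W, ∀ w : W, ρ w = w := by
  obtain ⟨W, hSW, hW, hmax⟩ := exists_max_ess S
  obtain ⟨Z, hZ, hZm⟩ := exists_max_disj W
  have hinj : Function.Injective (Z.mkQ ∘ₗ W.subtype) := by
    rw [injective_iff_map_eq_zero]
    rintro ⟨w, hw⟩ h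
    have : w ∈ Z := (Submodule.Quotient.mk_eq_zero Z).1 h
    exact Subtype.ext (Submodule.disjoint_def.1 hZ w this hw)
  obtain ⟨φ, hφ⟩ := hE.out (Z.mkQ ∘ₗ W.subtype) hinj W.subtype
  have key : ∀ x : E0 ⧸ Z, x ≠ 0 → ∃ (r : R) (w : W), w ≠ 0 ∧ r • x = Z.mkQ w := by
    intro x hx
    obtain ⟨x, rfl⟩ := Z.mkQ_surjective x
    have hxZ : x ∉ Z := fun h => hx ((Submodule.Quotient.mk_eq_zero Z).2 h)
    have : ¬ Disjoint (Z ⊔ R ∙ x) W := fun h => by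
      have := hZm _ le_sup_left h
      exact hxZ (this ▸ Submodule.mem_sup_right (Submodule.mem_span_singleton_self x))
    rw [Submodule.disjoint_def] at this
    push Not at this
    obtain ⟨w, hw1, hw2, hw0⟩ := this
    obtain ⟨z, hz, y, hy, rfl⟩ := Submodule.mem_sup.1 hw1
    obtain ⟨r, rfl⟩ := Submodule.mem_span_singleton.1 hy
    refine ⟨r, ⟨_, hw2⟩, fun h => hw0 (congrArg Subtype.val h), ?_⟩
    rw [map_add, (Submodule.Quotient.mk_eq_zero Z).2 hz |> fun h => (h : Z.mkQ z = 0), zero_add, map_smul]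
  have hφ' : ∀ w : W, φ (Z.mkQ w) = w := hφ
  have hWr : W ≤ LinearMap.range φ := fun w hw => ⟨Z.mkQ w, hφ' ⟨w, hw⟩⟩
  have hEss : Ess S (LinearMap.range φ) := by
    rintro _ ⟨x, rfl⟩ hx0
    obtain ⟨r, w, hw, h⟩ := key x (fun h => hx0 (by rw [h, map_zero]))
    obtain ⟨s, hs, hs0⟩ := hW w w.2 (fun h => hw (Subtype.ext h))
    have : (s * r) • φ x = s • (w : E0) := by rw [mul_smul, ← map_smul, h, hφ']
    exact ⟨s * r, this ▸ hs, this ▸ hs0⟩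
  have hr := hmax _ hWr hEss
  refine ⟨W, hSW, hW, LinearMap.codRestrict W (φ ∘ₗ Z.mkQ) (fun c => hr ▸ ⟨_, rfl⟩), fun w => Subtype.ext (hφ' w)⟩

lemma exists_hull (R : Type u) [CommRing R] [IsLocalRing R] : ∃ (E : Type u) (_ : AddCommGroup E) (_ : Module R E), Hull R E := by
  obtain ⟨E0, _, _, j, hE, hj⟩ := exists_injective (R := R) (R ⧸ IsLocalRing.maximalIdeal R)
  obtain ⟨W, hSW, hW, ρ, hρ⟩ := exists_retract hE (LinearMap.range j)
  refine ⟨W, inferInstance, inferInstance, ⟨⟨?_⟩, ?_⟩⟩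
  · intro X Y _ _ _ _ f hf g
    obtain ⟨h, hh⟩ := hE.out f hf (W.subtype ∘ₗ g)
    exact ⟨ρ ∘ₗ h, fun x => by rw [LinearMap.comp_apply, hh]; exact hρ _⟩
  · let y0 : R ⧸ IsLocalRing.maximalIdeal R := 1
    have hy0 : y0 ≠ 0 := one_ne_zero
    have hgen : ∀ y : R ⧸ IsLocalRing.maximalIdeal R, ∃ c : R, y = c • y0 := by
      intro y
      obtain ⟨c, rfl⟩ := Ideal.Quotient.mk_surjective y
      exact ⟨c, by rw [Algebra.smul_def, mul_one]; rfl⟩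
    refine ⟨⟨j y0, hSW ⟨_, rfl⟩⟩, fun h => hy0 (hj ((congrArg Subtype.val h).trans (map_zero j).symm)), ?_, ?_⟩
    · intro r hr
      refine Subtype.ext ?_
      change r • j y0 = 0
      have : r • y0 = 0 := (Submodule.Quotient.mk_eq_zero _).2 (by simpa using hr)
      rw [← map_smul, this, map_zero]
    · intro e he
      by_cases h0 : e = 0
      · exact ⟨0, by rw [zero_smul, h0]⟩
      obtain ⟨r, ⟨y, hy⟩, hr0⟩ := hW e e.2 (fun h => h0 (Subtype.ext h))
      have hru : IsUnit r := by
        by_contra hu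
        exact hr0 (congrArg Subtype.val (he r hu))
      obtain ⟨c, rfl⟩ := hgen y
      obtain ⟨v, rfl⟩ := hru
      refine ⟨(↑v⁻¹ : R) * c, Subtype.ext ?_⟩
      change (e : E0) = ((↑v⁻¹ : R) * c) • j y0
      rw [mul_smul, ← map_smul, hy, smul_smul, Units.inv_mul, one_smul]

end
end LC

namespace LC
section
variable {R : Type u} [CommRing R]
variable {M N L : Type u} [AddCommGroup M] [Module R M] [AddCommGroup N] [Module R N] [AddCommGroup L] [Module R L] {n : ℕ}

def ell (q : Ideal R) [q.IsPrime] (M : Type u) [AddCommGroup M] [Module R M] : ℕ∞ :=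
  Module.length (Localization.AtPrime q) (LocalizedModule q.primeCompl M)

variable (q : Ideal R) [hq : q.IsPrime]

lemma ell_add {f : M →ₗ[R] N} {g : N →ₗ[R] L} (h : SES f g) : ell q N = ell q M + ell q L :=
  Module.length_eq_add_of_exact (LocalizedModule.map q.primeCompl f) (LocalizedModule.map q.primeCompl g)
    (LocalizedModule.map_injective q.primeCompl f h.inj) (LocalizedModule.map_surjective q.primeCompl g h.surj)
    (LocalizedModule.map_exact q.primeCompl f g h.ex)

lemma ell_inj (f : M →ₗ[R] N) (hf : Function.Injective f) : ell q M ≤ ell q N := by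
  rw [ell_add q (ses_coker hf)]; exact le_self_add

lemma ell_surj (g : N →ₗ[R] L) (hg : Function.Surjective g) : ell q L ≤ ell q N := by
  rw [ell_add q (ses_ker hg)]; exact le_add_self

lemma ell_equiv (e : M ≃ₗ[R] N) : ell q M = ell q N :=
  le_antisymm (ell_inj q e.toLinearMap e.injective) (ell_surj q e.toLinearMap e.surjective)

lemma ell_zero (h : ∀ m : M, ∃ r, r ∉ q ∧ r • m = 0) : ell q M = 0 := by
  rw [ell, Module.length_eq_zero_iff, LocalizedModule.subsingleton_iff]
  intro m
  obtain ⟨r, h1, h2⟩ := h m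
  exact ⟨r, h1, h2⟩

lemma ell_zero_sub [Subsingleton M] : ell q M = 0 :=
  ell_zero q fun m => ⟨1, (Ideal.ne_top_iff_one q).1 hq.ne_top, Subsingleton.elim _ _⟩

lemma ell_prime : ell q (R ⧸ q) = 1 := by
  rw [ell, Module.length_eq_one_iff, isSimpleModule_iff_toSpanSingleton_surjective]
  constructor
  · by_contra h
    rw [not_nontrivial_iff_subsingleton, LocalizedModule.subsingleton_iff] at h
    obtain ⟨r, hr, h⟩ := h (q.mkQ 1)
    refine hr ?_
    have : q.mkQ (r • 1) = 0 := h
    have := (Submodule.Quotient.mk_eq_zero q).1 this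
    simpa using this
  · intro x hx y
    induction x using LocalizedModule.induction_on with
    | h m s =>
    induction y using LocalizedModule.induction_on with
    | h m' s' =>
    obtain ⟨r, rfl⟩ := q.mkQ_surjective m
    obtain ⟨r', rfl⟩ := q.mkQ_surjective m'
    have hr : r ∈ q.primeCompl := by
      intro h
      apply hx
      have : q.mkQ r = 0 := (Submodule.Quotient.mk_eq_zero q).2 h
      rw [this, LocalizedModule.zero_mk]
    refine ⟨Localization.mk (s.1 * r') (⟨r, hr⟩ * s'), ?_⟩
    rw [LinearMap.toSpanSingleton_apply, LocalizedModule.mk_smul_mk, LocalizedModule.mk_eq]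
    refine ⟨1, ?_⟩
    simp only [one_smul, Submonoid.smul_def, Submonoid.coe_mul, ← map_smul, smul_eq_mul]
    congr 1
    ring

lemma prime_eq {p q : Ideal R} [p.IsPrime] (h : p ≤ q) (h1 : ringKrullDim (R ⧸ p) ≤ (n : WithBot (WithTop ℕ)))
    (h2 : (n : WithBot (WithTop ℕ)) ≤ ringKrullDim (R ⧸ q)) : p = q := by
  by_contra e
  obtain ⟨x, hx, hxp⟩ := SetLike.exists_of_lt (lt_of_le_of_ne h e)
  have h3 : Ideal.Quotient.mk p x ∈ nonZeroDivisors (R ⧸ p) := by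
    rw [mem_nonZeroDivisors_iff_ne_zero]
    rwa [Ne, Ideal.Quotient.eq_zero_iff_mem]
  have := ringKrullDim_succ_le_of_surjective (Ideal.Quotient.factor h) (Ideal.Quotient.factor_surjective h) h3
    (by simpa [Ideal.Quotient.eq_zero_iff_mem] using hx)
  have h4 : (n : WithBot (WithTop ℕ)) + 1 ≤ n := (add_le_add_left h2 1).trans (this.trans h1)
  have h5 : ((n + 1 : ℕ) : WithBot (WithTop ℕ)) ≤ (n : ℕ) := by push_cast; exact h4
  rw [Nat.cast_le] at h5
  omega

lemma ell_quot_zero {p : Ideal R} (h : ¬ p ≤ q) (hM : p ≤ Module.annihilator R M) : ell q M = 0 := by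
  obtain ⟨x, hx, hxq⟩ := Set.not_subset.1 h
  exact ell_zero q fun m => ⟨x, hxq, Module.mem_annihilator.1 (hM hx) m⟩

lemma ell_fin [IsNoetherianRing R] (h2 : (n : WithBot (WithTop ℕ)) ≤ ringKrullDim (R ⧸ q))
    (M : Type u) [AddCommGroup M] [Module R M] [Module.Finite R M] (hd : DD R M n) : ell q M < ⊤ := by
  have key := pind (R := R) n (fun N _ _ => ell q N < ⊤)
  refine key ?_ ?_ ?_ M hd
  · intro N _ _ _; rw [ell_zero_sub]; exact ENat.coe_lt_top 0
  · intro p _ hp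
    by_cases e : p ≤ q
    · have := prime_eq e hp h2
      subst this
      rw [ell_prime]; exact ENat.one_lt_top
    · rw [ell_quot_zero q e (Ideal.annihilator_quotient (I := p)).ge]; exact ENat.coe_lt_top 0
  · intro N₁ N₂ N₃ _ _ _ _ _ _ _ _ _ f g hs _ _ _ h1 h3
    rw [ell_add q hs]; exact ENat.add_lt_top.2 ⟨h1, h3⟩

lemma exists_next (h2 : ((n + 1 : ℕ) : WithBot (WithTop ℕ)) ≤ ringKrullDim (R ⧸ q)) :
    ∃ q' : Ideal R, q'.IsPrime ∧ q < q' ∧ (n : WithBot (WithTop ℕ)) ≤ ringKrullDim (R ⧸ q') := by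
  rw [ringKrullDim_quotient] at h2
  obtain ⟨l, hl⟩ := Order.le_krullDim_iff.1 h2
  have hlt : ∀ i j : Fin (l.length + 1), i < j → l i < l j := fun i j h => l.strictMono h
  let i1 : Fin (l.length + 1) := ⟨1, by omega⟩
  refine ⟨(l i1).1.asIdeal, (l i1).1.2, ?_, ?_⟩
  · have h0 := hlt 0 i1 (by simp [i1, Fin.lt_def])
    have h1 : q ≤ (l 0).1.asIdeal := (l 0).2
    exact lt_of_le_of_lt h1 h0
  · rw [ringKrullDim_quotient]; refine Order.le_krullDim_iff.2 ?_
    refine ⟨⟨n, fun i => ⟨(l ⟨i.1 + 1, by omega⟩).1, ?_⟩, ?_⟩, rfl⟩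
    · have : l i1 ≤ l ⟨i.1 + 1, by omega⟩ := l.strictMono.monotone (by simp [i1, Fin.le_def])
      exact this
    · intro i
      exact hlt ⟨i.1 + 1, by omega⟩ ⟨i.1 + 1 + 1, by omega⟩ (by simp [Fin.lt_def])

lemma precomplete_pi (I : Ideal R) [hI : IsPrecomplete I R] (k : ℕ) : IsPrecomplete I (Fin k → R) := by
  constructor
  intro f hf
  have hc : ∀ i : Fin k, ∃ L : R, ∀ n, f n i ≡ L [SMOD (I ^ n • ⊤ : Submodule R R)] := by
    intro i
    refine hI.prec ?_
    intro m n hmn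
    have := hf hmn
    rw [SModEq.sub_mem] at this ⊢
    have h2 := Submodule.mem_map_of_mem (f := LinearMap.proj (R := R) (φ := fun _ : Fin k => R) i) this
    rw [Submodule.map_smul''] at h2
    exact Submodule.smul_mono le_rfl le_top h2
  choose L hL using hc
  refine ⟨L, fun n => ?_⟩
  rw [SModEq.sub_mem, pi_eq_sum_univ (f n - L)]
  refine Submodule.sum_mem _ fun i _ => ?_
  have := hL i n
  rw [SModEq.sub_mem, smul_eq_mul, Ideal.mul_top] at this
  exact Submodule.smul_mem_smul this Submodule.mem_top

lemma complete_fg (I : Ideal R) [hI : IsPrecomplete I R] (K : Type u) [AddCommGroup K] [Module R K] [IsHausdorff I K]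
    (hK : Module.Finite R (K ⧸ (I • ⊤ : Submodule R K))) : Module.Finite R K := by
  obtain ⟨k, f, hf⟩ := Module.Finite.exists_fin' R (K ⧸ (I • ⊤ : Submodule R K))
  obtain ⟨g, hg⟩ := Module.projective_lifting_property (I • ⊤ : Submodule R K).mkQ f (Submodule.mkQ_surjective _)
  have := precomplete_pi I k
  have hs : Function.Surjective g := surjective_of_mkQ_comp_surjective (I := I) (by rw [hg]; exact hf)
  exact Module.Finite.of_surjective g hs
end
end LC

namespace LC
section
variable {R : Type u} [CommRing R]
variable {M N L : Type u} [AddCommGroup M] [Module R M] [AddCommGroup N] [Module R N] [AddCommGroup L] [Module R L] {n : ℕ}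
variable {F G K : Type u} [AddCommGroup F] [Module R F] [AddCommGroup G] [Module R G] [AddCommGroup K] [Module R K]

lemma ell_compare (q : Ideal R) [q.IsPrime] (φ : F →ₗ[R] K) (hφ : Function.Injective φ) (x : R)
    (hx : ∀ k : K, x • k = 0 → k = 0) {g : F →ₗ[R] G} (hs : SES (x • LinearMap.id : F →ₗ[R] F) g)
    (hC : ell q (K ⧸ LinearMap.range φ) < ⊤) :
    ell q G = ell q (K ⧸ LinearMap.range (x • LinearMap.id : K →ₗ[R] K)) := by
  rw [← ell_equiv q (hs.ex.linearEquivOfSurjective hs.surj)]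
  let X : K →ₗ[R] K := x • LinearMap.id
  let Y : F →ₗ[R] F := x • LinearMap.id
  let P : Submodule R K := LinearMap.range (φ ∘ₗ Y)
  have h1 : LinearMap.range Y ≤ P.comap φ := by
    rintro _ ⟨f, rfl⟩; exact ⟨f, rfl⟩
  have h2 : LinearMap.range φ ≤ P.comap X := by
    rintro _ ⟨f, rfl⟩; exact ⟨f, by simp [X, Y]⟩
  have h3 : P ≤ LinearMap.range φ := by
    rintro _ ⟨f, rfl⟩; exact ⟨Y f, rfl⟩
  have h4 : P ≤ LinearMap.range X := by
    rintro _ ⟨f, rfl⟩; exact ⟨φ f, by simp [X, Y]⟩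
  have s1 : SES (Submodule.mapQ (LinearMap.range Y) P φ h1) (Submodule.factor h3) := by
    refine ⟨?_, Submodule.factor_surjective h3, ?_⟩
    · rw [injective_iff_map_eq_zero]
      intro z hz
      obtain ⟨f, rfl⟩ := Submodule.mkQ_surjective _ z
      obtain ⟨f', hf'⟩ := (Submodule.Quotient.mk_eq_zero P).1 hz
      exact (Submodule.Quotient.mk_eq_zero _).2 ⟨f', hφ hf'⟩
    · intro z
      constructor
      · intro hz
        obtain ⟨k, rfl⟩ := Submodule.mkQ_surjective _ z
        obtain ⟨f', hf'⟩ := (Submodule.Quotient.mk_eq_zero (LinearMap.range φ)).1 hz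
        exact ⟨(LinearMap.range Y).mkQ f', congrArg P.mkQ hf'⟩
      · rintro ⟨w, rfl⟩
        obtain ⟨f, rfl⟩ := Submodule.mkQ_surjective _ w
        exact (Submodule.Quotient.mk_eq_zero (LinearMap.range φ)).2 ⟨f, rfl⟩
  have s2 : SES (Submodule.mapQ (LinearMap.range φ) P X h2) (Submodule.factor h4) := by
    refine ⟨?_, Submodule.factor_surjective h4, ?_⟩
    · rw [injective_iff_map_eq_zero]
      intro z hz
      obtain ⟨k, rfl⟩ := Submodule.mkQ_surjective _ z
      obtain ⟨f', hf'⟩ := (Submodule.Quotient.mk_eq_zero P).1 hz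
      refine (Submodule.Quotient.mk_eq_zero _).2 ⟨f', ?_⟩
      refine sub_eq_zero.1 (hx _ ?_)
      have : x • φ f' = x • k := by rw [← map_smul]; exact hf'
      rw [smul_sub, this, sub_self]
    · intro z
      constructor
      · intro hz
        obtain ⟨k, rfl⟩ := Submodule.mkQ_surjective _ z
        obtain ⟨f', hf'⟩ := (Submodule.Quotient.mk_eq_zero (LinearMap.range X)).1 hz
        exact ⟨(LinearMap.range φ).mkQ f', congrArg P.mkQ hf'⟩
      · rintro ⟨w, rfl⟩
        obtain ⟨f, rfl⟩ := Submodule.mkQ_surjective _ w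
        exact (Submodule.Quotient.mk_eq_zero (LinearMap.range X)).2 ⟨f, rfl⟩
  have e := (ell_add q s1).symm.trans (ell_add q s2)
  rw [add_comm] at e
  exact ENat.add_right_injective_of_ne_top hC.ne e

lemma prod_ses {x : R} {g : F →ₗ[R] G} (hs : SES (x • LinearMap.id : F →ₗ[R] F) g) :
    SES (x • LinearMap.id : (F × F) →ₗ[R] (F × F)) (LinearMap.prodMap g g) := by
  refine ⟨?_, ?_, ?_⟩
  · intro a b h
    refine Prod.ext (hs.inj (congrArg Prod.fst h)) (hs.inj (congrArg Prod.snd h))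
  · exact Function.Surjective.prodMap hs.surj hs.surj
  · rintro ⟨a, b⟩
    constructor
    · intro h
      obtain ⟨u, hu⟩ := (hs.ex a).1 (congrArg Prod.fst h)
      obtain ⟨v, hv⟩ := (hs.ex b).1 (congrArg Prod.snd h)
      exact ⟨(u, v), Prod.ext hu hv⟩
    · rintro ⟨⟨u, v⟩, h⟩
      exact Prod.ext ((hs.ex a).2 ⟨u, congrArg Prod.fst h⟩) ((hs.ex b).2 ⟨v, congrArg Prod.snd h⟩)

lemma ell_prod (q : Ideal R) [q.IsPrime] : ell q (G × G) = ell q G + ell q G :=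
  ell_add q (f := LinearMap.inl R G G) (g := LinearMap.snd R G G)
    ⟨LinearMap.inl_injective, LinearMap.snd_surjective, by
      rintro ⟨a, b⟩
      constructor
      · intro h; exact ⟨a, Prod.ext rfl h.symm⟩
      · rintro ⟨c, h⟩; exact (congrArg Prod.snd h).symm⟩

lemma exists_kill (q : Ideal R) [hq : q.IsPrime] [Module.Finite R M] (h : ∀ m : M, ∃ r, r ∉ q ∧ r • m = 0) :
    ∃ c, c ∉ q ∧ c ∈ Module.annihilator R M := by
  have h1 : (⟨q, hq⟩ : PrimeSpectrum R) ∉ Module.support R M := by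
    rw [Module.notMem_support_iff']; exact h
  rw [Module.mem_support_iff_of_finite] at h1
  obtain ⟨c, h2, h3⟩ := Set.not_subset.1 h1
  exact ⟨c, h3, h2⟩

/-- saturation of a submodule with respect to a prime -/
def sat (q : Ideal R) [hq : q.IsPrime] (S : Submodule R K) : Submodule R K where
  carrier := {k | ∃ c, c ∉ q ∧ c • k ∈ S}
  zero_mem' := ⟨1, (Ideal.ne_top_iff_one q).1 hq.ne_top, by simp⟩
  add_mem' := by
    rintro a b ⟨c, hc, h⟩ ⟨d, hd, h'⟩
    refine ⟨c * d, fun e => (hq.mem_or_mem e).elim hc hd, ?_⟩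
    rw [smul_add]
    refine S.add_mem ?_ ?_
    · rw [mul_comm, mul_smul]; exact S.smul_mem _ h
    · rw [mul_smul]; exact S.smul_mem _ h'
  smul_mem' := by
    rintro r a ⟨c, hc, h⟩
    exact ⟨c, hc, by rw [smul_comm]; exact S.smul_mem _ h⟩

lemma rank_one [IsNoetherianRing R] (q q' : Ideal R) [hq : q.IsPrime] [hq' : q'.IsPrime] (hle : q ≤ q') {x : R} (hx : x ∉ q) (hxq : x ∈ q')
    (h1 : ringKrullDim (R ⧸ q) ≤ ((n+1 : ℕ) : WithBot (WithTop ℕ)))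
    (h2 : (n : WithBot (WithTop ℕ)) ≤ ringKrullDim (R ⧸ q'))
    [Module.Finite R K] (hk : ∀ r ∈ q, ∀ k : K, r • k = 0) (ht : ∀ c, c ∉ q → ∀ k : K, c • k = 0 → k = 0)
    (he : ell q' (K ⧸ LinearMap.range (x • LinearMap.id : K →ₗ[R] K)) ≤ ell q' (R ⧸ (q ⊔ Ideal.span {x})))
    (α β : K) : ∃ c d : R, (c ∉ q ∨ d ∉ q) ∧ c • α + d • β = 0 := by
  by_contra hcon
  push Not at hcon
  have hI : q ⊔ Ideal.span {x} ≤ q' := sup_le hle ((Ideal.span_singleton_le_iff_mem _).2 hxq)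
  have e1 : ell q' (R ⧸ (q ⊔ Ideal.span {x})) < ⊤ := ell_fin q' h2 _ ((DD_quot _).2
    (dim_drop hx le_sup_left (Ideal.mem_sup_right (Ideal.mem_span_singleton_self x)) h1))
  have e0 : 1 ≤ ell q' (R ⧸ (q ⊔ Ideal.span {x})) := by
    rw [← ell_prime q']
    exact ell_surj q' (Submodule.factor hI) (Submodule.factor_surjective hI)
  let ψ (k : K) : (R ⧸ q) →ₗ[R] K := q.liftQ (LinearMap.toSpanSingleton R K k) (fun r hr => hk r hr k)
  have hψ : ∀ k r, ψ k (q.mkQ r) = r • k := fun k r => rfl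
  let φ0 : ((R ⧸ q) × (R ⧸ q)) →ₗ[R] K := LinearMap.coprod (ψ α) (ψ β)
  let S := sat q (LinearMap.range φ0)
  have hS : ∀ z, φ0 z ∈ S := fun z => ⟨1, (Ideal.ne_top_iff_one q).1 hq.ne_top, by rw [one_smul]; exact ⟨z, rfl⟩⟩
  let φ : ((R ⧸ q) × (R ⧸ q)) →ₗ[R] S := LinearMap.codRestrict S φ0 hS
  have hφ : Function.Injective φ := by
    rw [injective_iff_map_eq_zero]
    rintro ⟨a, b⟩ h
    obtain ⟨a, rfl⟩ := q.mkQ_surjective a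
    obtain ⟨b, rfl⟩ := q.mkQ_surjective b
    have h' : a • α + b • β = 0 := congrArg Subtype.val h
    have ha : a ∈ q ∧ b ∈ q := by
      by_contra hab
      refine hcon a b ?_ h'
      by_contra hh
      push Not at hh
      exact hab hh
    exact Prod.ext ((Submodule.Quotient.mk_eq_zero q).2 ha.1) ((Submodule.Quotient.mk_eq_zero q).2 ha.2)
  have hCk : ∀ m : (S ⧸ LinearMap.range φ), ∃ r, r ∉ q ∧ r • m = 0 := by
    intro m
    obtain ⟨⟨m, c, hc, z, hz⟩, rfl⟩ := Submodule.mkQ_surjective _ m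
    refine ⟨c, hc, ?_⟩
    refine (Submodule.Quotient.mk_eq_zero (LinearMap.range φ)).2 ⟨z, Subtype.ext hz⟩
  obtain ⟨c, hc, hc'⟩ := exists_kill q hCk
  have hDD : DD R (S ⧸ LinearMap.range φ) n := by
    refine dim_drop hc ?_ hc' h1
    intro r hr
    rw [Module.mem_annihilator]
    intro m
    obtain ⟨m, rfl⟩ := Submodule.mkQ_surjective _ m
    rw [← map_smul]
    have : r • m = 0 := Subtype.ext (hk r hr m.1)
    rw [this, map_zero]
  have e2 := ell_fin q' h2 _ hDD
  have e3 := ell_compare q' φ hφ x (fun k h => Subtype.ext (ht x hx k.1 (congrArg Subtype.val h))) (prod_ses (mulses q hx)) e2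
  have hle : LinearMap.range (x • LinearMap.id : S →ₗ[R] S) ≤ (LinearMap.range (x • LinearMap.id : K →ₗ[R] K)).comap S.subtype := by
    rintro _ ⟨k, rfl⟩
    exact ⟨k.1, rfl⟩
  have e4 : ell q' (S ⧸ LinearMap.range (x • LinearMap.id : S →ₗ[R] S)) ≤ ell q' (K ⧸ LinearMap.range (x • LinearMap.id : K →ₗ[R] K)) := by
    refine ell_inj q' (Submodule.mapQ _ _ S.subtype hle) ?_
    rw [injective_iff_map_eq_zero]
    intro z hz
    obtain ⟨k, rfl⟩ := Submodule.mkQ_surjective _ z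
    obtain ⟨f, hf⟩ := (Submodule.Quotient.mk_eq_zero (LinearMap.range (x • LinearMap.id : K →ₗ[R] K))).1 hz
    refine (Submodule.Quotient.mk_eq_zero _).2 ⟨⟨f, ?_⟩, Subtype.ext hf⟩
    obtain ⟨c, hc, h⟩ := k.2
    refine ⟨c * x, fun h => (hq.mem_or_mem h).elim hc hx, ?_⟩
    rw [mul_smul]
    have hf' : x • f = k.1 := hf
    rw [hf']; exact h
  rw [ell_prod] at e3
  have e5 := e3.le.trans (e4.trans he)
  generalize ell q' (R ⧸ (q ⊔ Ideal.span {x})) = e at *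
  lift e to ℕ using e1.ne
  norm_cast at e5 e0
  omega

lemma ell_le_one (q : Ideal R) [hq : q.IsPrime] (hk : ∀ r ∈ q, ∀ k : K, r • k = 0) (ht : ∀ c, c ∉ q → ∀ k : K, c • k = 0 → k = 0)
    (h : ∀ α β : K, ∃ c d : R, (c ∉ q ∨ d ∉ q) ∧ c • α + d • β = 0) : ell q K ≤ 1 := by
  by_cases h0 : ∀ k : K, k = 0
  · have : Subsingleton K := ⟨fun a b => (h0 a).trans (h0 b).symm⟩
    rw [ell_zero_sub]; exact zero_le
  push Not at h0
  obtain ⟨α, hα⟩ := h0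
  let ψ : (R ⧸ q) →ₗ[R] K := q.liftQ (LinearMap.toSpanSingleton R K α) (fun r hr => hk r hr α)
  have hψ : ∀ r, ψ (q.mkQ r) = r • α := fun r => rfl
  have s : SES (LinearMap.range ψ).subtype (LinearMap.range ψ).mkQ := ⟨Subtype.val_injective, Submodule.mkQ_surjective _, by intro z; simp⟩
  rw [ell_add q s]
  have h1 : ell q (LinearMap.range ψ) ≤ 1 := by
    rw [← ell_prime q]; exact ell_surj q ψ.rangeRestrict ψ.surjective_rangeRestrict
  have h2 : ell q (K ⧸ LinearMap.range ψ) = 0 := by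
    refine ell_zero q fun m => ?_
    obtain ⟨β, rfl⟩ := Submodule.mkQ_surjective _ m
    obtain ⟨c, d, h3, h4⟩ := h α β
    refine ⟨d, ?_, ?_⟩
    · intro hd
      rw [hk d hd, add_zero] at h4
      have hc := h3.resolve_right (fun h => h hd)
      exact hα (ht c hc α h4)
    · refine (Submodule.Quotient.mk_eq_zero (LinearMap.range ψ)).2 ⟨q.mkQ (-c), ?_⟩
      rw [hψ, neg_smul]
      exact neg_eq_of_add_eq_zero_right h4
  rw [h2, add_zero]; exact h1
end
end LC

namespace LC
section
variable {R : Type u} [CommRing R]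
variable {M N L : Type u} [AddCommGroup M] [Module R M] [AddCommGroup N] [Module R N] [AddCommGroup L] [Module R L] {n : ℕ}
variable {A B E : Type u} [AddCommGroup A] [Module R A] [AddCommGroup B] [Module R B] [AddCommGroup E] [Module R E]

lemma fac (s : A →ₗ[R] B) (hs : Function.Surjective s) (α : A →ₗ[R] E) (h : ∀ a, s a = 0 → α a = 0) :
    ∃ β : B →ₗ[R] E, β ∘ₗ s = α := by
  let e := s.quotKerEquivOfSurjective hs
  refine ⟨(LinearMap.ker s).liftQ α h ∘ₗ e.symm.toLinearMap, ?_⟩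
  ext a
  have : e.symm (s a) = (LinearMap.ker s).mkQ a := by
    rw [LinearEquiv.symm_apply_eq]; rfl
  simp only [LinearMap.comp_apply, LinearEquiv.coe_coe, this]
  rfl

abbrev KK (E : Type u) [AddCommGroup E] [Module R E] (m : Ideal R) (n : ℕ) (N : Type u) [AddCommGroup N] [Module R N] : Type u :=
  H m n N →ₗ[R] E

def CL (E : Type u) [AddCommGroup E] [Module R E] (m : Ideal R) (n : ℕ) (N : Type u) [AddCommGroup N] [Module R N] : Prop :=
  Module.Finite R (KK E m n N) ∧ ∀ (q : Ideal R) [q.IsPrime], (n : WithBot (WithTop ℕ)) ≤ ringKrullDim (R ⧸ q) → ell q (KK E m n N) ≤ ell q N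

lemma left_exact [IsNoetherianRing R] (f : A →ₗ[R] B) (g : B →ₗ[R] E) (hf : Function.Injective f) (h : ∀ b, g b = 0 → ∃ a, f a = b)
    (hA : Module.Finite R A) (hE : Module.Finite R E) : Module.Finite R B := by
  have := isNoetherian_of_isNoetherianRing_of_finite R A
  have := isNoetherian_of_isNoetherianRing_of_finite R E
  have h1 : LinearMap.ker g = Submodule.map f ⊤ ⊓ LinearMap.ker g := by
    refine le_antisymm (fun b hb => ⟨?_, hb⟩) inf_le_right
    obtain ⟨a, rfl⟩ := h b hb
    exact ⟨a, trivial, rfl⟩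
  refine ⟨Submodule.fg_of_fg_map_of_fg_inf_ker g (IsNoetherian.noetherian _) ?_⟩
  rw [top_inf_eq]
  have h2 : LinearMap.ker g = Submodule.map f (Submodule.comap f (LinearMap.ker g)) := by
    rw [Submodule.map_comap_eq, LinearMap.range_eq_map]; exact h1
  rw [h2]
  exact (IsNoetherian.noetherian _).map f

lemma ell_left (q : Ideal R) [q.IsPrime] (f : A →ₗ[R] B) (g : B →ₗ[R] E) (h : ∀ b, g b = 0 → ∃ a, f a = b) :
    ell q B ≤ ell q A + ell q E := by
  have s := ses_ker (g := g.rangeRestrict) g.surjective_rangeRestrict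
  rw [ell_add q s]
  refine add_le_add ?_ (ell_inj q (LinearMap.range g).subtype Subtype.val_injective)
  refine (ell_inj q (Submodule.inclusion (p := LinearMap.ker g.rangeRestrict) (p' := LinearMap.range f) ?_) (Submodule.inclusion_injective _)).trans
    (ell_surj q f.rangeRestrict f.surjective_rangeRestrict)
  intro b hb
  obtain ⟨a, ha⟩ := h b (congrArg Subtype.val hb)
  exact ⟨a, ha⟩

lemma CL_ex [IsNoetherianRing R] [IsLocalRing R] (E : Type u) [AddCommGroup E] [Module R E] (m : Ideal R) 
   (N₁ N₂ N₃ : Type u) [AddCommGroup N₁] [Module R N₁] [Module.Finite R N₁] [AddCommGroup N₂] [Module R N₂] [Module.Finite R N₂]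
      [AddCommGroup N₃] [Module R N₃] [Module.Finite R N₃] (f : N₁ →ₗ[R] N₂) (g : N₂ →ₗ[R] N₃) (hs : SES f g) (d1 : DD R N₁ n)
      (h1 : CL E m n N₁) (h3 : CL E m n N₃) : CL E m n N₂ := by
  let F : KK E m n N₃ →ₗ[R] KK E m n N₂ := LinearMap.lcomp R E (map m n g)
  let G : KK E m n N₂ →ₗ[R] KK E m n N₁ := LinearMap.lcomp R E (map m n f)
  have hsur := map_surj m hs d1
  have hF : Function.Injective F := by
    rw [injective_iff_map_eq_zero]
    intro α hα
    ext u
    obtain ⟨v, rfl⟩ := hsur u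
    exact LinearMap.congr_fun hα v
  have hG : ∀ b, G b = 0 → ∃ a, F a = b := by
    intro b hb
    refine fac _ hsur b fun a ha => ?_
    obtain ⟨y, rfl⟩ := hex2 hs a ha
    exact LinearMap.congr_fun hb y
  refine ⟨left_exact F G hF hG h3.1 h1.1, fun q _ hq => ?_⟩
  refine (ell_left q F G hG).trans ?_
  rw [ell_add q hs, add_comm]
  exact add_le_add (h1.2 q hq) (h3.2 q hq)

lemma CL_zero (E : Type u) [AddCommGroup E] [Module R E] (m : Ideal R) (h : HZ m n N) : CL E m n N := by
  have : Subsingleton (KK E m n N) := ⟨fun a b => by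
    ext u; rw [h u, map_zero, map_zero]⟩
  refine ⟨inferInstance, fun q _ _ => ?_⟩
  rw [ell_zero_sub]; exact zero_le

lemma H0 [IsLocalRing R] : ∃ h0 : H (IsLocalRing.maximalIdeal R) 0 (R ⧸ IsLocalRing.maximalIdeal R),
    ∀ x : H (IsLocalRing.maximalIdeal R) 0 (R ⧸ IsLocalRing.maximalIdeal R), ∃ c : R, x = c • h0 := by
  have hm : ∃ t : ℕ, IsLocalRing.maximalIdeal R ^ t ≤ IsLocalRing.maximalIdeal R := ⟨1, by rw [pow_one]⟩
  refine ⟨of _ _ _ _ hm (Abelian.Ext.mk₀ (ModuleCat.ofHom LinearMap.id)), fun x => ?_⟩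
  obtain ⟨I, hI, u, rfl⟩ := exists_of x
  obtain ⟨f, rfl⟩ := exists_hom u
  by_cases h : I = ⊤
  · refine ⟨0, ?_⟩
    have hf : f = 0 := by
      ext
      have h1 : I.mkQ 1 = 0 := (Submodule.Quotient.mk_eq_zero I).2 (by rw [h]; trivial)
      have h2 : f (I.mkQ 1) = 0 := by rw [h1, map_zero]
      exact h2
    have h3 : (ModuleCat.ofHom f) = 0 := by rw [hf]; rfl
    rw [zero_smul, h3, Abelian.Ext.mk₀_zero, map_zero]
  · have hle := IsLocalRing.le_maximalIdeal h
    obtain ⟨c, hc⟩ := Submodule.mkQ_surjective _ (f (I.mkQ 1))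
    refine ⟨c, ?_⟩
    have hf : f = (c • LinearMap.id) ∘ₗ qm hle := by
      ext
      have h2 : f (I.mkQ 1) = c • (IsLocalRing.maximalIdeal R).mkQ 1 := by
        rw [← hc, ← map_smul, smul_eq_mul, mul_one]
      exact h2
    rw [hf, ← pre_hom, of_res hI hm, ← map_smul, ← Abelian.Ext.mk₀_smul]
    rfl

lemma CL_base [IsNoetherianRing R] [IsLocalRing R] (hE : Hull R E) :
    CL E (IsLocalRing.maximalIdeal R) 0 (R ⧸ IsLocalRing.maximalIdeal R) := by
  obtain ⟨h0, hh⟩ := H0 (R := R)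
  obtain ⟨e0, -, he, hs⟩ := hE.soc
  have hk : ∀ r ∈ IsLocalRing.maximalIdeal R, r • h0 = 0 := fun r hr =>
    smul_zero_of r (fun y => by
      obtain ⟨y, rfl⟩ := Submodule.mkQ_surjective _ y
      rw [← map_smul]
      exact (Submodule.Quotient.mk_eq_zero _).2 (Ideal.mul_mem_right _ _ hr)) h0
  let ψ : (R ⧸ IsLocalRing.maximalIdeal R) →ₗ[R] E := (IsLocalRing.maximalIdeal R).liftQ (LinearMap.toSpanSingleton R E e0) (fun r hr => he r hr)
  let ev : KK E (IsLocalRing.maximalIdeal R) 0 (R ⧸ IsLocalRing.maximalIdeal R) →ₗ[R] LinearMap.range ψ :=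
    LinearMap.codRestrict _ (LinearMap.applyₗ h0) (fun α => by
      obtain ⟨c, hc⟩ := hs (α h0) (fun r hr => by rw [← map_smul, hk r hr, map_zero])
      exact ⟨Submodule.mkQ _ c, hc.symm⟩)
  have hev : Function.Injective ev := by
    rw [injective_iff_map_eq_zero]
    intro α hα
    have h1 : α h0 = 0 := congrArg Subtype.val hα
    ext x
    obtain ⟨c, rfl⟩ := hh x
    rw [map_smul, h1, smul_zero]; rfl
  refine ⟨Module.Finite.of_injective ev hev, fun q _ _ => ?_⟩
  exact (ell_inj q ev hev).trans (ell_surj q ψ.rangeRestrict ψ.surjective_rangeRestrict)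

/-- the quotient `K/xK` embeds -/
lemma quot_emb [IsNoetherianRing R] [IsLocalRing R] (E : Type u) [AddCommGroup E] [Module R E] (m p : Ideal R) [p.IsPrime] {x : R} (hx : x ∉ p)
    (hd : ringKrullDim (R ⧸ p) ≤ ((n+1 : ℕ) : WithBot (WithTop ℕ))) :
    ∃ f : (KK E m (n+1) (R ⧸ p) ⧸ LinearMap.range (x • LinearMap.id : KK E m (n+1) (R ⧸ p) →ₗ[R] KK E m (n+1) (R ⧸ p))) →ₗ[R]
      KK E m n (R ⧸ (p ⊔ Ideal.span {x})), Function.Injective f := by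
  let D : KK E m (n+1) (R ⧸ p) →ₗ[R] KK E m n (R ⧸ (p ⊔ Ideal.span {x})) := LinearMap.lcomp R E (dl m (mulses p hx))
  refine ⟨Submodule.liftQ _ D ?_, ?_⟩
  · rintro _ ⟨α, rfl⟩
    ext u
    have h1 := map_dl (mulses p hx) u
    rw [map_smul'] at h1
    have h2 : α (x • dl m (mulses p hx) u) = 0 := by rw [h1, map_zero]
    rw [map_smul] at h2
    exact h2
  · rw [injective_iff_map_eq_zero]
    intro z hz
    obtain ⟨α, rfl⟩ := Submodule.mkQ_surjective _ z
    have hz : D α = 0 := hz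
    let X : H m (n+1) (R ⧸ p) →ₗ[R] H m (n+1) (R ⧸ p) := x • LinearMap.id
    obtain ⟨β, hβ⟩ := fac X (fun u => quot_div m p hd hx u) α (fun a ha => by
      obtain ⟨y, rfl⟩ := hex1 (mulses p hx) a (by rw [map_smul']; exact ha)
      exact LinearMap.congr_fun hz y)
    refine (Submodule.Quotient.mk_eq_zero _).2 ⟨β, ?_⟩
    rw [← hβ]
    ext u
    exact (map_smul β x u).symm

lemma KK_haus [IsNoetherianRing R] [IsLocalRing R] (E : Type u) [AddCommGroup E] [Module R E] (m : Ideal R) : IsHausdorff m (KK E m n N) := by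
  constructor
  intro α hα
  ext u
  obtain ⟨t, ht⟩ := tors u
  have h1 := hα t
  rw [SModEq.zero] at h1
  refine Submodule.smul_induction_on (p := fun γ => γ u = 0) h1 ?_ ?_
  · intro r hr γ _
    rw [LinearMap.smul_apply, ← map_smul, ht r hr, map_zero]
  · intro γ δ h h'
    rw [LinearMap.add_apply, h, h', add_zero]
end
end LC

namespace LC
section
variable {R : Type u} [CommRing R] [IsNoetherianRing R] [IsLocalRing R] [hc : IsAdicComplete (IsLocalRing.maximalIdeal R) R]
variable {n : ℕ}
variable {E : Type u} [AddCommGroup E] [Module R E]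

lemma lt_aux (z : WithBot ℕ∞) (h : z < ((n+1 : ℕ) : WithBot ℕ∞)) : z ≤ (n : WithBot ℕ∞) := by
  induction z with
  | bot => exact bot_le
  | coe z =>
    induction z with
    | top => exact absurd h (by simp)
    | coe z =>
      have h' : z < n + 1 := by exact_mod_cast h
      exact_mod_cast Nat.lt_succ_iff.1 h'

/-- the inductive statement -/
def CLall (R : Type u) [CommRing R] [IsLocalRing R] (E : Type u) [AddCommGroup E] [Module R E] (n : ℕ) : Prop :=
  ∀ (M : Type u) [AddCommGroup M] [Module R M] [Module.Finite R M], DD R M n → CL E (IsLocalRing.maximalIdeal R) n M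

lemma K_fin (ih : CLall R E n) (p : Ideal R) [hp : p.IsPrime] (hd : ringKrullDim (R ⧸ p) ≤ ((n+1 : ℕ) : WithBot (WithTop ℕ))) :
    Module.Finite R (KK E (IsLocalRing.maximalIdeal R) (n+1) (R ⧸ p)) := by
  by_cases hpm : p = IsLocalRing.maximalIdeal R
  · subst hpm
    refine (CL_zero E _ ?_).1
    refine vanish _ 0 (n+1) (Nat.succ_pos n) _ ((DD_quot _).2 ?_)
    letI := Ideal.Quotient.field (IsLocalRing.maximalIdeal R)
    rw [ringKrullDim_eq_zero_of_field]; rfl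
  obtain ⟨x, hxm, hx⟩ := SetLike.exists_of_lt (lt_of_le_of_ne (IsLocalRing.le_maximalIdeal hp.ne_top) hpm)
  obtain ⟨f, hf⟩ := quot_emb E (IsLocalRing.maximalIdeal R) p hx hd
  have h1 := (ih (R ⧸ (p ⊔ Ideal.span {x})) ((DD_quot _).2
    (dim_drop hx le_sup_left (Ideal.mem_sup_right (Ideal.mem_span_singleton_self x)) hd))).1
  have h2 := Module.Finite.of_injective f hf
  have := KK_haus (n := n+1) (N := R ⧸ p) E (IsLocalRing.maximalIdeal R)
  have := hc.toIsPrecomplete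
  refine complete_fg (IsLocalRing.maximalIdeal R) _ ?_
  have hle : LinearMap.range (x • LinearMap.id : KK E (IsLocalRing.maximalIdeal R) (n+1) (R ⧸ p) →ₗ[R] KK E (IsLocalRing.maximalIdeal R) (n+1) (R ⧸ p)) ≤
      (IsLocalRing.maximalIdeal R) • ⊤ := by
    rintro _ ⟨α, rfl⟩
    exact Submodule.smul_mem_smul hxm trivial
  exact Module.Finite.of_surjective (Submodule.factor hle) (Submodule.factor_surjective hle)

lemma K_kill (m p : Ideal R) (r : R) (hr : r ∈ p) (α : KK E m n (R ⧸ p)) : r • α = 0 := by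
  ext u
  rw [LinearMap.smul_apply, ← map_smul, smul_zero_of r (fun y => by
      obtain ⟨y, rfl⟩ := Submodule.mkQ_surjective _ y
      rw [← map_smul]
      exact (Submodule.Quotient.mk_eq_zero _).2 (Ideal.mul_mem_right _ _ hr)) u, map_zero]; rfl

lemma K_tf (m p : Ideal R) [p.IsPrime] (hd : ringKrullDim (R ⧸ p) ≤ ((n+1 : ℕ) : WithBot (WithTop ℕ)))
    (c : R) (hc : c ∉ p) (α : KK E m (n+1) (R ⧸ p)) (h : c • α = 0) : α = 0 := by
  ext u
  obtain ⟨v, rfl⟩ := quot_div m p hd hc u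
  rw [map_smul]
  exact LinearMap.congr_fun h v

lemma K_dep (ih : CLall R E n) (q : Ideal R) [hq : q.IsPrime] (hd : ringKrullDim (R ⧸ q) ≤ ((n+1 : ℕ) : WithBot (WithTop ℕ)))
    (hd' : ((n+1 : ℕ) : WithBot (WithTop ℕ)) ≤ ringKrullDim (R ⧸ q))
    (α β : KK E (IsLocalRing.maximalIdeal R) (n+1) (R ⧸ q)) : ∃ c d : R, (c ∉ q ∨ d ∉ q) ∧ c • α + d • β = 0 := by
  obtain ⟨q', hq', hlt, h2⟩ := exists_next q hd'
  obtain ⟨x, hxq, hx⟩ := SetLike.exists_of_lt hlt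
  obtain ⟨f, hf⟩ := quot_emb E (IsLocalRing.maximalIdeal R) q hx hd
  have h1 := (ih (R ⧸ (q ⊔ Ideal.span {x})) ((DD_quot _).2
    (dim_drop hx le_sup_left (Ideal.mem_sup_right (Ideal.mem_span_singleton_self x)) hd))).2 q' h2
  have := K_fin ih q hd
  exact rank_one q q' hlt.le hx hxq hd h2 (K_kill _ q) (K_tf _ q hd) ((ell_inj q' f hf).trans h1) α β

theorem CL_all (hE : Hull R E) : ∀ n : ℕ, CLall R E n := by
  intro n
  induction n with
  | zero =>
    intro M _ _ _ hd
    have key := pind (R := R) 0 (fun N _ _ => CL E (IsLocalRing.maximalIdeal R) 0 N)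
    refine key ?_ ?_ ?_ M hd
    · intro N _ _ _; exact CL_zero E _ (fun x => H_sub x)
    · intro p _ hp
      have := dim_zero hp
      subst this
      exact CL_base hE
    · intro N₁ N₂ N₃ _ _ _ _ _ _ _ _ _ f g hs d1 _ _ h1 h3
      exact CL_ex E _ N₁ N₂ N₃ f g hs d1 h1 h3
  | succ n ih =>
    intro M _ _ _ hd
    have key := pind (R := R) (n+1) (fun N _ _ => CL E (IsLocalRing.maximalIdeal R) (n+1) N)
    refine key ?_ ?_ ?_ M hd
    · intro N _ _ _; exact CL_zero E _ (fun x => H_sub x)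
    · intro p _ hp
      refine ⟨K_fin ih p hp, fun q _ hq => ?_⟩
      by_cases hpq : p ≤ q
      · have := prime_eq hpq hp hq
        subst this
        rw [ell_prime]
        exact ell_le_one p (K_kill _ p) (K_tf _ p hp) (K_dep ih p hp hq)
      · rw [ell_quot_zero q hpq (fun r hr => Module.mem_annihilator.2 (K_kill _ p r hr))]
        exact zero_le
    · intro N₁ N₂ N₃ _ _ _ _ _ _ _ _ _ f g hs d1 _ _ h1 h3
      exact CL_ex E _ N₁ N₂ N₃ f g hs d1 h1 h3

lemma exists_fun (hE : Hull R E) {A : Type u} [AddCommGroup A] [Module R A] (a : A) (ha : a ≠ 0) : ∃ f : A →ₗ[R] E, f a ≠ 0 := by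
  obtain ⟨e0, he0, he, -⟩ := hE.soc
  have hinj := hE.inj
  let φ : R →ₗ[R] A := LinearMap.toSpanSingleton R A a
  have hk : LinearMap.ker φ ≤ IsLocalRing.maximalIdeal R := by
    refine IsLocalRing.le_maximalIdeal ?_
    intro h
    have : (1 : R) ∈ LinearMap.ker φ := by rw [h]; trivial
    apply ha
    have h2 : (1 : R) • a = 0 := this
    simpa using h2
  let ψ : (R ⧸ LinearMap.ker φ) →ₗ[R] E := (LinearMap.ker φ).liftQ (LinearMap.toSpanSingleton R E e0) (fun r hr => he r (hk hr))
  obtain ⟨h, hh⟩ := hinj.out ((LinearMap.ker φ).liftQ φ le_rfl) (by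
    rw [← LinearMap.ker_eq_bot]; exact Submodule.ker_liftQ_eq_bot _ _ _ le_rfl) ψ
  refine ⟨h, ?_⟩
  have h3 := hh ((LinearMap.ker φ).mkQ 1)
  have h4 : ((LinearMap.ker φ).liftQ φ le_rfl) ((LinearMap.ker φ).mkQ 1) = a := one_smul R a
  have h5 : ψ ((LinearMap.ker φ).mkQ 1) = e0 := one_smul R e0
  rw [h4, h5] at h3
  rw [h3]; exact he0

theorem star (q a b : Ideal R) [hq : q.IsPrime] (hd : ringKrullDim (R ⧸ q) ≤ ((n+1 : ℕ) : WithBot (WithTop ℕ)))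
    (ha : a ≤ IsLocalRing.maximalIdeal R) (hb : b ≤ IsLocalRing.maximalIdeal R)
    (h1 : ¬ HZ a (n+1) (R ⧸ q)) (h2 : ¬ HZ b (n+1) (R ⧸ q)) : ¬ HZ (a ⊓ b) (n+1) (R ⧸ q) := by
  intro h0
  have hDD := (DD_quot q).2 hd
  have hd' : ((n+1 : ℕ) : WithBot (WithTop ℕ)) ≤ ringKrullDim (R ⧸ q) := by
    by_contra hlt
    refine h1 (vanish a n (n+1) (Nat.lt_succ_self n) _ ((DD_quot q).2 ?_))
    exact lt_aux _ (lt_of_not_ge hlt)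
  obtain ⟨E, _, _, hE⟩ := exists_hull R
  unfold HZ at h1 h2
  push Not at h1 h2
  obtain ⟨x, hx⟩ := h1
  obtain ⟨y, hy⟩ := h2
  obtain ⟨f, hf⟩ := exists_fun hE x hx
  obtain ⟨g, hg⟩ := exists_fun hE y hy
  have hs : ∀ (u : H a (n+1) (R ⧸ q)) (v : H b (n+1) (R ⧸ q)), ∃ w : H (IsLocalRing.maximalIdeal R) (n+1) (R ⧸ q),
      chg (n+1) (R ⧸ q) ha w = u ∧ chg (n+1) (R ⧸ q) hb w = v := by
    intro u v
    obtain ⟨w, hw1, hw2⟩ := MV a b h0 u v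
    obtain ⟨z, rfl⟩ := chg_surj (sup_le ha hb) le_rfl (n+1) (R ⧸ q) hDD w
    rw [chg_chg] at hw1 hw2
    exact ⟨z, hw1, hw2⟩
  obtain ⟨c, d, hcd, e⟩ := K_dep (CL_all hE n) q hd hd' (f ∘ₗ chg (n+1) (R ⧸ q) ha) (g ∘ₗ chg (n+1) (R ⧸ q) hb)
  have e' : ∀ u v, c • f u + d • g v = 0 := by
    intro u v
    obtain ⟨w, rfl, rfl⟩ := hs u v
    exact LinearMap.congr_fun e w
  rcases hcd with hc | hc
  · obtain ⟨u, hu⟩ := quot_div a q hd hc x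
    have := e' u 0
    rw [map_zero, smul_zero, add_zero, ← map_smul, hu] at this
    exact hf this
  · obtain ⟨u, hu⟩ := quot_div b q hd hc y
    have := e' 0 u
    rw [map_zero, smul_zero, zero_add, ← map_smul, hu] at this
    exact hg this
end
end LC

namespace LC
section
variable {R : Type u} [CommRing R]

lemma IsAtt_equiv {A B : Type u} [AddCommGroup A] [Module R A] [AddCommGroup B] [Module R B] (e : A ≃ₗ[R] B) (p : Ideal R) (h : IsAtt p A) : IsAtt p B := by
  obtain ⟨hp, K, hK⟩ := h
  refine ⟨hp, K.map e.toLinearMap, ?_⟩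
  rw [hK]
  exact LinearEquiv.annihilator_eq (Submodule.Quotient.equiv K _ e rfl)

lemma not_att_zero {A : Type u} [AddCommGroup A] [Module R A] (p : Ideal R) (h : ∀ a : A, a = 0) : ¬ IsAtt p A := by
  rintro ⟨hp, K, hK⟩
  apply hp.ne_top
  rw [hK, Ideal.eq_top_iff_one, Module.mem_annihilator]
  intro m
  obtain ⟨m, rfl⟩ := Submodule.mkQ_surjective _ m
  rw [h m, map_zero, smul_zero]

theorem final [IsNoetherianRing R] [IsLocalRing R]
    [IsAdicComplete (IsLocalRing.maximalIdeal R) R]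
    (M : Type u) [AddCommGroup M] [Module R M] [Module.Finite R M] (n : ℕ) (hd : DD R M (n+1)) (a₁ a₂ : Ideal R) :
    ∃ b : Ideal R, ∀ p : Ideal R, IsAtt p (H b (n+1) M) ↔ IsAtt p (H a₁ (n+1) M) ∧ IsAtt p (H a₂ (n+1) M) := by
  by_cases t1 : a₁ = ⊤
  · subst t1
    refine ⟨⊤, fun p => ⟨fun h => absurd h (not_att_zero p H_top), fun h => h.1⟩⟩
  by_cases t2 : a₂ = ⊤
  · subst t2
    refine ⟨⊤, fun p => ⟨fun h => absurd h (not_att_zero p H_top), fun h => h.2⟩⟩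
  have l1 := IsLocalRing.le_maximalIdeal t1
  have l2 := IsLocalRing.le_maximalIdeal t2
  refine ⟨a₁ ⊓ a₂, fun p => ?_⟩
  rw [attF _ p hd, attF _ p hd, attF _ p hd]
  constructor
  · rintro ⟨hp, hM, h⟩
    have hD : DD R (R ⧸ p) (n+1) := (DD_quot p).2 ((dim_mono hM).trans hd)
    refine ⟨⟨hp, hM, fun h0 => h fun z => ?_⟩, ⟨hp, hM, fun h0 => h fun z => ?_⟩⟩
    · obtain ⟨w, rfl⟩ := chg_surj (inf_le_left : a₁ ⊓ a₂ ≤ a₁) l1 (n+1) (R ⧸ p) hD z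
      rw [h0 w, map_zero]
    · obtain ⟨w, rfl⟩ := chg_surj (inf_le_right : a₁ ⊓ a₂ ≤ a₂) l2 (n+1) (R ⧸ p) hD z
      rw [h0 w, map_zero]
  · rintro ⟨⟨hp, hM, h1⟩, ⟨-, -, h2⟩⟩
    exact ⟨hp, hM, star p a₁ a₂ ((dim_mono hM).trans hd) l1 l2 h1 h2⟩
end
end LC

theorem stmt8 (R : Type u) [CommRing R] [IsNoetherianRing R] [IsLocalRing R]
    [IsAdicComplete (IsLocalRing.maximalIdeal R) R]
    (M : Type u) [AddCommGroup M] [Module R M] [Module.Finite R M]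
    (n : ℕ) (hn : 2 ≤ n)
    (hdim : ringKrullDim (R ⧸ Module.annihilator R M) = (n : WithBot (WithTop ℕ)))
    (a₁ a₂ : Ideal R) :
    ∃ b : Ideal R,
      attachedPrimes R ((localCohomology b n).obj (ModuleCat.of R M)) =
        attachedPrimes R ((localCohomology a₁ n).obj (ModuleCat.of R M)) ∩
          attachedPrimes R ((localCohomology a₂ n).obj (ModuleCat.of R M)) := by
  obtain ⟨k, rfl⟩ : ∃ k, n = k + 1 := ⟨n - 1, by omega⟩
  obtain ⟨b, hb⟩ := LC.final M k hdim.le a₁ a₂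
  have key : ∀ (J : Ideal R) (p : Ideal R), p ∈ attachedPrimes R ((localCohomology J (k+1)).obj (ModuleCat.of R M)) ↔
      LC.IsAtt p (LC.H J (k+1) M) := by
    intro J p
    obtain ⟨e⟩ := LC.bridge J k M
    exact ⟨fun h => LC.IsAtt_equiv e p h, fun h => LC.IsAtt_equiv e.symm p h⟩
  refine ⟨b, Set.ext fun p => ?_⟩
  refine (key b p).trans ((hb p).trans (and_congr (key a₁ p).symm (key a₂ p).symm))

end
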